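/- Let H_0 be the free Dirac operator on ℝ³ (with mass and speed of light equal to 1) and P_± its spectral projections onto the positive and negative spectral subspaces. Then for every u in P_+ dom(|H_0|^{1/2}) ∪ P_− dom(|H_0|^{1/2}) one has |( |x|^{-1} u, u )| ≤ (1/2)(π/2 + 2/π) ‖ |H_0|^{1/2} u ‖², where ( |x|^{-1} u, u ) = ∫_{ℝ³} |u(x)|² / |x| dx. -/

import Mathlib

noncomputable section

open Complex Filter Topology MeasureTheory

namespace Paper

variable {X : Type*} [NormedAddCommGroup X] [NormedSpace ℂ X]

/-- `R` is a (two-sided) bounded resolvent of the unbounded operator `T` at the point `z`. -/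
def IsResolventAt (T : X →ₗ.[ℂ] X) (z : ℂ) (R : X →L[ℂ] X) : Prop :=
  (∀ u : T.domain, R (T u - z • (u : X)) = u) ∧
  (∀ y : X, ∃ hy : R y ∈ T.domain, T ⟨R y, hy⟩ - z • R y = y)

/-- The resolvent set of an unbounded operator. -/
def resolventSet (T : X →ₗ.[ℂ] X) : Set ℂ := {z | ∃ R, IsResolventAt T z R}

/-- The spectrum of an unbounded operator. -/
def spec (T : X →ₗ.[ℂ] X) : Set ℂ := (resolventSet T)ᶜ

open Classical in
/-- The resolvent operator of `T` at `z` (junk value `0` if `z` is not in the resolvent set). -/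
def res (T : X →ₗ.[ℂ] X) (z : ℂ) : X →L[ℂ] X :=
  if h : z ∈ resolventSet T then Classical.choose h else 0

open Classical in
/-- Application of an unbounded operator, with junk value `0` outside of the domain. -/
def pApply (T : X →ₗ.[ℂ] X) (u : X) : X :=
  if h : u ∈ T.domain then T ⟨u, h⟩ else 0

/-- `R` is a bounded resolvent at `z` of the part of `T` in the range of the
(not necessarily orthogonal) projection `Q`. -/
def IsPartResolventAt (T : X →ₗ.[ℂ] X) (Q : X →L[ℂ] X) (z : ℂ) (R : X →L[ℂ] X) : Prop :=
  (∀ y, R (Q y) = R y) ∧ (∀ y, Q (R y) = R y) ∧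
  (∀ y, ∃ hy : R y ∈ T.domain, T ⟨R y, hy⟩ - z • R y = Q y) ∧
  (∀ u : T.domain, Q (u : X) = (u : X) → R (T u - z • (u : X)) = (u : X))

/-- The spectrum of the part `T|_{ran Q}` of `T` in the range of the projection `Q`. -/
def partSpec (T : X →ₗ.[ℂ] X) (Q : X →L[ℂ] X) : Set ℂ :=
  {z | ¬∃ R, IsPartResolventAt T Q z R}

/-- `T` is decomposed according to `X = Q₊X ∔ Q₋X`: the `Q₊, Q₋` are complementary (bounded)
projections whose ranges are invariant under `T`. -/
def DecomposedBy (T : X →ₗ.[ℂ] X) (Qp Qm : X →L[ℂ] X) : Prop :=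
  Qp + Qm = 1 ∧ IsIdempotentElem Qp ∧ IsIdempotentElem Qm ∧
  (∀ u : T.domain, ∃ hp : Qp (u : X) ∈ T.domain, T ⟨Qp (u : X), hp⟩ = Qp (T u)) ∧
  (∀ u : T.domain, ∃ hm : Qm (u : X) ∈ T.domain, T ⟨Qm (u : X), hm⟩ = Qm (T u))

/-- `D` is a core for the closed operator `T`: the closure of the restriction of `T` to `D`
is again `T`. -/
def IsCore (T : X →ₗ.[ℂ] X) (D : Submodule ℂ X) : Prop :=
  D ≤ T.domain ∧ (T.domRestrict D).closure = T

/-- The operator `W⁻¹ T W` (with `W' = W⁻¹`). -/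
def conjPMap (W W' : X →L[ℂ] X) (T : X →ₗ.[ℂ] X) : X →ₗ.[ℂ] X where
  domain := T.domain.comap (W : X →ₗ[ℂ] X)
  toFun := (W' : X →ₗ[ℂ] X) ∘ₗ (T.toFun ∘ₗ ((W : X →ₗ[ℂ] X).restrict fun _ hx => hx))

/-- The linear span of the graph of `f` restricted to `D`; if `f` is linear on `D` this is
the graph of the corresponding operator with domain `D`. -/
def graphSpan (D : Submodule ℂ X) (f : X → X) : Submodule ℂ (X × X) :=
  Submodule.span ℂ {p : X × X | p.1 ∈ D ∧ p.2 = f p.1}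

/-- The unbounded operator with domain `D` acting as `f` (obtained from the span of the
graph of `f|_D`). -/
def pmapOf (D : Submodule ℂ X) (f : X → X) : X →ₗ.[ℂ] X := (graphSpan D f).toLinearPMap
section Hilbert

variable {H : Type*} [NormedAddCommGroup H] [InnerProductSpace ℂ H] [CompleteSpace H]

local notation "⟪" x ", " y "⟫" => @inner ℂ _ _ x y

/-- The inverse of a bounded operator `J`, as an unbounded operator (defined via the
flipped graph of `J`; if `J` is injective this is the genuine inverse with domain `ran J`). -/
def pinv (J : H →L[ℂ] H) : H →ₗ.[ℂ] H :=
  ((LinearMap.graph (J : H →ₗ[ℂ] H)).map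
    ((LinearEquiv.prodComm ℂ H H) : H × H →ₗ[ℂ] H × H)).toLinearPMap

/-- For `R` self-adjoint, `|R| = √(R²)`. -/
def absCLM (R : H →L[ℂ] H) : H →L[ℂ] H := CFC.sqrt (R * R)

/-- For `R = H₀⁻¹` with `H₀` self-adjoint, this is `|H₀|^{-1/2} = √(|R|)`. -/
def invSqrtAbs (R : H →L[ℂ] H) : H →L[ℂ] H := CFC.sqrt (absCLM R)

/-- For `R = H₀⁻¹` with `H₀` self-adjoint, this is the unbounded operator `|H₀|^{1/2}`,
realized as the inverse of `|H₀|^{-1/2}`; its domain is `dom |H₀|^{1/2}`. -/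
def sqrtAbsPMap (R : H →L[ℂ] H) : H →ₗ.[ℂ] H := pinv (invSqrtAbs R)

/-- `U` is the sign `sign(H₀) = sign(H₀⁻¹) = sign(R)` of the boundedly invertible self-adjoint
operator `H₀ = R⁻¹`: a self-adjoint involution with `R U = U R = |R|`. -/
def IsSignOf (U R : H →L[ℂ] H) : Prop :=
  IsSelfAdjoint U ∧ U * U = 1 ∧ R * U = absCLM R ∧ U * R = absCLM R

/-- The quadratic form `h₀` represented by `H₀ = R⁻¹`:
`h₀[u,w] = (|H₀|^{1/2}u, sign(H₀)|H₀|^{1/2}w)`, linear in `u` and conjugate-linear in `w`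
(values outside `dom |H₀|^{1/2}` are junk). -/
def h0form (R U : H →L[ℂ] H) (u w : H) : ℂ :=
  ⟪U (pApply (sqrtAbsPMap R) w), pApply (sqrtAbsPMap R) u⟫

/-- `v` is a sesquilinear form on `Q` (linear in the first, conjugate-linear in the second
argument, as in the paper). -/
def SesqOn (Q : Submodule ℂ H) (v : H → H → ℂ) : Prop :=
  (∀ u₁ u₂ w, u₁ ∈ Q → u₂ ∈ Q → w ∈ Q → v (u₁ + u₂) w = v u₁ w + v u₂ w) ∧
  (∀ (c : ℂ) u w, u ∈ Q → w ∈ Q → v (c • u) w = c * v u w) ∧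
  (∀ u w₁ w₂, u ∈ Q → w₁ ∈ Q → w₂ ∈ Q → v u (w₁ + w₂) = v u w₁ + v u w₂) ∧
  (∀ (c : ℂ) u w, u ∈ Q → w ∈ Q → v u (c • w) = (starRingEnd ℂ) c * v u w)

/-- `T` is the operator associated with the densely defined sesquilinear form `h`
with form domain `Q` (in the sense of the paper):
`T` is closed and densely defined, `dom T, dom T* ⊆ Q`, `(Tu, w) = h[u, w]` for
`u ∈ dom T`, `w ∈ Q`, and `(u, T*w) = h[u, w]` for `u ∈ Q`, `w ∈ dom T*`.
(The paper's inner product `(·,·)` is linear in the first argument, so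
`(x, y) = ⟪y, x⟫` in Mathlib conventions.) -/
def IsAssocForm (Q : Submodule ℂ H) (h : H → H → ℂ) (T : H →ₗ.[ℂ] H) : Prop :=
  T.IsClosed ∧ Dense (T.domain : Set H) ∧ T.domain ≤ Q ∧ T.adjoint.domain ≤ Q ∧
  (∀ u : T.domain, ∀ w ∈ Q, ⟪w, T u⟫ = h u w) ∧
  (∀ u ∈ Q, ∀ w : T.adjoint.domain, ⟪T.adjoint w, u⟫ = h u w)

/-- `‖H_{a,b}^{1/2} u‖ = (a‖u‖² + b‖|H₀|^{1/2}u‖²)^{1/2}` for `u ∈ dom |H₀|^{1/2}`,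
where `H_{a,b} = a + b|H₀|` and `R = H₀⁻¹`. -/
def habNorm (R : H →L[ℂ] H) (a b : ℝ) (u : H) : ℝ :=
  Real.sqrt (a * ‖u‖ ^ 2 + b * ‖pApply (sqrtAbsPMap R) u‖ ^ 2)

/-- `Pp, Pm` are the spectral projections of the bounded self-adjoint operator `R` onto its
positive and negative spectral subspaces (`R` is assumed injective, e.g. the inverse of a
self-adjoint operator, so that the pair is uniquely determined). -/
def IsPosNegPair (R Pp Pm : H →L[ℂ] H) : Prop :=
  Pp + Pm = 1 ∧ IsSelfAdjoint Pp ∧ IsSelfAdjoint Pm ∧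
  IsIdempotentElem Pp ∧ IsIdempotentElem Pm ∧
  Pp * R = R * Pp ∧
  (∀ x : H, 0 ≤ (⟪Pp x, R (Pp x)⟫).re) ∧ (∀ x : H, (⟪Pm x, R (Pm x)⟫).re ≤ 0)

/-- Membership in the Schatten-von Neumann class of order `p`, via the Schmidt
representation `A = ∑ sₙ ⟪eₙ, ·⟫ fₙ` with `(sₙ) ∈ ℓᵖ`. -/
def MemSchatten (p : ℝ) (A : H →L[ℂ] H) : Prop :=
  ∃ (s : ℕ → ℝ) (e f : ℕ → H), Orthonormal ℂ e ∧ Orthonormal ℂ f ∧ (∀ n, 0 ≤ s n) ∧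
    Summable (fun n => s n ^ p) ∧
    ∀ x : H, HasSum (fun n => s n • (⟪e n, x⟫ • f n)) (A x)

end Hilbert


section Dirac

open ComplexConjugate

/-- Euclidean 3-space. -/
abbrev V3 := EuclideanSpace ℝ (Fin 3)

/-- The spinor space `ℂ⁴`. -/
abbrev C4 := EuclideanSpace ℂ (Fin 4)

/-- Two-component spinors `ℂ²`. -/
abbrev C2 := EuclideanSpace ℂ (Fin 2)

/-- The Hilbert space `L²(ℝ³, ℂ⁴)`. -/
abbrev DSp := MeasureTheory.Lp (α := V3) C4 2 (volume : Measure V3)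

/-- The Hilbert space `L²(ℝ³, ℂ²)` (for the Pauli operator). -/
abbrev DSp2 := MeasureTheory.Lp (α := V3) C2 2 (volume : Measure V3)

/-- Application of a `4 × 4` matrix to a spinor. -/
def mapp (M : Matrix (Fin 4) (Fin 4) ℂ) (ξ : C4) : C4 :=
  (WithLp.equiv 2 (Fin 4 → ℂ)).symm (M.mulVec (WithLp.equiv 2 (Fin 4 → ℂ) ξ))

/-- Application of a `2 × 2` matrix to a two-component spinor. -/
def mapp2 (M : Matrix (Fin 2) (Fin 2) ℂ) (ξ : C2) : C2 :=
  (WithLp.equiv 2 (Fin 2 → ℂ)).symm (M.mulVec (WithLp.equiv 2 (Fin 2 → ℂ) ξ))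

/-- The Pauli matrices `σ₁, σ₂, σ₃`. -/
def pauli : Fin 3 → Matrix (Fin 2) (Fin 2) ℂ
  | 0 => !![0, 1; 1, 0]
  | 1 => !![0, -Complex.I; Complex.I, 0]
  | 2 => !![1, 0; 0, -1]

/-- The Dirac matrices `α_j = [[0, σ_j], [σ_j, 0]]`. -/
def diracα : Fin 3 → Matrix (Fin 4) (Fin 4) ℂ
  | 0 => !![0, 0, 0, 1;
            0, 0, 1, 0;
            0, 1, 0, 0;
            1, 0, 0, 0]
  | 1 => !![0, 0, 0, -Complex.I;
            0, 0, Complex.I, 0;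
            0, -Complex.I, 0, 0;
            Complex.I, 0, 0, 0]
  | 2 => !![0, 0, 1, 0;
            0, 0, 0, -1;
            1, 0, 0, 0;
            0, -1, 0, 0]

/-- The Dirac matrix `β = diag(1, 1, -1, -1)`. -/
def diracβ : Matrix (Fin 4) (Fin 4) ℂ :=
  !![1, 0, 0, 0;
     0, 1, 0, 0;
     0, 0, -1, 0;
     0, 0, 0, -1]

/-- The projection onto the upper two spinor components. -/
def upperMat : Matrix (Fin 4) (Fin 4) ℂ :=
  !![1, 0, 0, 0;
     0, 1, 0, 0;
     0, 0, 0, 0;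
     0, 0, 0, 0]

/-- The projection onto the lower two spinor components. -/
def lowerMat : Matrix (Fin 4) (Fin 4) ℂ :=
  !![0, 0, 0, 0;
     0, 0, 0, 0;
     0, 0, 1, 0;
     0, 0, 0, 1]

/-- The classical action of the free Dirac operator
`H₀ = β - i Σ_j α_j ∂_j` on a differentiable function. -/
def diracAct (f : V3 → C4) (x : V3) : C4 :=
  mapp diracβ (f x) -
    Complex.I • ∑ j : Fin 3, mapp (diracα j) (fderiv ℝ f x (EuclideanSpace.single j (1 : ℝ)))

/-- The classical action of the magnetic Dirac operator
`H_A = β - i Σ_j α_j ∂_j - Σ_j A_j α_j` (i.e. with `-iσ·∇` replaced by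
`-iσ·∇_A = -iσ·∇ - σ·A`). -/
def diracActA (A : V3 → V3) (f : V3 → C4) (x : V3) : C4 :=
  mapp diracβ (f x) -
    Complex.I • ∑ j : Fin 3, mapp (diracα j) (fderiv ℝ f x (EuclideanSpace.single j (1 : ℝ))) -
    ∑ j : Fin 3, (A x j : ℂ) • mapp (diracα j) (f x)

/-- The classical action of the operator `-iσ·∇_A = -iσ·∇ - σ·A` on two-component spinors. -/
def pauliDiracAct (A : V3 → V3) (f : V3 → C2) (x : V3) : C2 :=
  (-Complex.I) • ∑ j : Fin 3, mapp2 (pauli j) (fderiv ℝ f x (EuclideanSpace.single j (1 : ℝ))) -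
    ∑ j : Fin 3, (A x j : ℂ) • mapp2 (pauli j) (f x)

/-- A smooth compactly supported (test) function. -/
def IsTestFn (f : V3 → C4) : Prop := ContDiff ℝ (⊤ : ℕ∞) f ∧ HasCompactSupport f

/-- A smooth compactly supported function supported away from the origin. -/
def IsTestFnAway (f : V3 → C4) : Prop :=
  ContDiff ℝ (⊤ : ℕ∞) f ∧ HasCompactSupport f ∧ (0 : V3) ∉ tsupport f

/-- The subspace of `L²(ℝ³, ℂ⁴)` of (classes of) test functions. -/
def testSub : Submodule ℂ DSp :=
  Submodule.span ℂ {u : DSp | ∃ f : V3 → C4, IsTestFn f ∧ ⇑u =ᵐ[volume] f}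

/-- The subspace of (classes of) test functions supported away from the origin,
`C₀^∞(ℝ³ \ {0})⁴`. -/
def testSubAway : Submodule ℂ DSp :=
  Submodule.span ℂ {u : DSp | ∃ f : V3 → C4, IsTestFnAway f ∧ ⇑u =ᵐ[volume] f}

/-- `H₀` is the free Dirac operator on `ℝ³` (units `m = c = ħ = 1`): it is self-adjoint,
acts as `diracAct` on test functions, and the test functions form a core (which, together
with self-adjointness, determines it uniquely; its domain is `H¹(ℝ³, ℂ⁴)`). -/
def IsFreeDirac (H0 : DSp →ₗ.[ℂ] DSp) : Prop :=
  H0.adjoint = H0 ∧ IsCore H0 testSub ∧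
  ∀ (u : DSp) (f : V3 → C4), IsTestFn f → ⇑u =ᵐ[volume] f →
    ∃ hu : u ∈ H0.domain, ⇑(H0 ⟨u, hu⟩) =ᵐ[volume] fun x => diracAct f x

/-- `HA` is the magnetic Dirac operator with vector potential `A`: the self-adjoint
closure of the classical magnetic Dirac operator on `C₀^∞(ℝ³ \ {0})⁴` (on which it is
essentially self-adjoint). -/
def IsMagneticDirac (A : V3 → V3) (HA : DSp →ₗ.[ℂ] DSp) : Prop :=
  HA.adjoint = HA ∧ IsCore HA testSubAway ∧
  ∀ (u : DSp) (f : V3 → C4), IsTestFnAway f → ⇑u =ᵐ[volume] f →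
    ∃ hu : u ∈ HA.domain, ⇑(HA ⟨u, hu⟩) =ᵐ[volume] fun x => diracActA A f x

/-- `Bfun` is the distributional curl of the vector potential `A`:
`(curl A)_i = ∂_{i+1} A_{i+2} - ∂_{i+2} A_{i+1}` (cyclically), tested against smooth
compactly supported functions. -/
def IsCurlOf (A : V3 → V3) (Bfun : V3 → V3) : Prop :=
  ∀ (i : Fin 3) (φ : V3 → ℝ), ContDiff ℝ (⊤ : ℕ∞) φ → HasCompactSupport φ →
    ∫ x : V3, Bfun x i * φ x =
      ∫ x : V3, (A x (i + 1) * fderiv ℝ φ x (EuclideanSpace.single (i + 2) (1 : ℝ)) -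
        A x (i + 2) * fderiv ℝ φ x (EuclideanSpace.single (i + 1) (1 : ℝ)))

end Dirac

theorem inv_one_add_sq_mul_self_le_arctan {p : ℝ} (hp : 0 ≤ p) :
    p / (1 + p ^ 2) ≤ Real.arctan p := by
  have hd : ∀ x : ℝ, HasDerivAt (fun x : ℝ => Real.arctan x - x / (1 + x ^ 2))
      (1 / (1 + x ^ 2) - (1 * (1 + x ^ 2) - x * (2 * x)) / (1 + x ^ 2) ^ 2) x := by
    intro x
    have h1 : HasDerivAt (fun x : ℝ => 1 + x ^ 2) (2 * x) x := by
      simpa using (hasDerivAt_pow 2 x).const_add 1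
    exact (Real.hasDerivAt_arctan x).sub ((hasDerivAt_id x).div h1 (by positivity))
  have hm : Monotone (fun x : ℝ => Real.arctan x - x / (1 + x ^ 2)) := by
    apply monotone_of_hasDerivAt_nonneg hd
    intro x
    have : 1 / (1 + x ^ 2) - (1 * (1 + x ^ 2) - x * (2 * x)) / (1 + x ^ 2) ^ 2
        = 2 * x ^ 2 / (1 + x ^ 2) ^ 2 := by field_simp; ring
    simp only [Pi.zero_apply]
    rw [this]; positivity
  have := hm hp
  simp only [Real.arctan_zero, zero_div, sub_zero] at this
  linarith

theorem arctan_le_self {p : ℝ} (hp : 0 ≤ p) : Real.arctan p ≤ p := by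
  rcases hp.eq_or_lt with rfl | hp
  · simp
  · have := Real.lt_tan (Real.arctan_pos.2 hp) (Real.arctan_lt_pi_div_two p)
    rw [Real.tan_arctan] at this
    exact this.le

theorem two_div_pi_mul_sq_le_arctan {p : ℝ} (hp : 0 ≤ p) :
    2 / Real.pi * p ^ 2 ≤ (p ^ 2 + 1) * Real.arctan p := by
  have hpi := Real.pi_gt_three
  have hpi0 := Real.pi_pos
  rcases le_total p 1 with h1 | h1
  · have h := inv_one_add_sq_mul_self_le_arctan hp
    rw [div_le_iff₀ (by positivity)] at h
    have : 2 / Real.pi * p ^ 2 ≤ 1 * p ^ 2 := by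
      gcongr
      rw [div_le_one hpi0]; linarith
    nlinarith
  · have h4 : Real.pi / 4 ≤ Real.arctan p := by
      rw [← Real.arctan_one]; exact Real.arctan_strictMono.monotone h1
    have : 2 / Real.pi ≤ Real.pi / 4 := by
      rw [div_le_div_iff₀ hpi0 (by norm_num)]; nlinarith
    nlinarith [sq_nonneg p, mul_le_mul_of_nonneg_right this (sq_nonneg p)]

theorem tix_poly_nonneg {c : ℝ} (h1 : 1 / 2 ≤ c) (h2 : c ≤ 1) :
    0 ≤ 32 * c ^ 3 + 6.28 * (1 + c ^ 2) ^ 2 - 6.9349 * (1 + c ^ 2) ^ 3 := by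
  obtain ⟨d, rfl⟩ : ∃ d, c = 1 / 2 + d := ⟨c - 1 / 2, by ring⟩
  have hd : 0 ≤ d := by linarith
  obtain ⟨e, he⟩ : ∃ e, e = 1 / 2 - d := ⟨_, rfl⟩
  have he0 : 0 ≤ e := by linarith
  obtain rfl : d = 1 / 2 - e := by linarith
  nlinarith [mul_nonneg hd he0, mul_nonneg (mul_nonneg hd he0) hd,
    mul_nonneg (mul_nonneg hd he0) he0, pow_nonneg he0 3, pow_nonneg hd 3, pow_nonneg he0 2,
    pow_nonneg he0 4, pow_nonneg he0 5, pow_nonneg he0 6, mul_nonneg hd (pow_nonneg he0 5),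
    mul_nonneg hd (pow_nonneg he0 4), mul_nonneg hd (pow_nonneg he0 3),
    mul_nonneg (pow_nonneg hd 2) (pow_nonneg he0 4),
    mul_nonneg (pow_nonneg hd 3) (pow_nonneg he0 3),
    mul_nonneg (pow_nonneg hd 4) (pow_nonneg he0 2),
    mul_nonneg (pow_nonneg hd 5) (pow_nonneg he0 1), pow_nonneg hd 6]

theorem tix_arctan_ineq {c : ℝ} (h0 : 0 < c) (h1 : c < 1) :
    2 * Real.pi * Real.arctan c + 8 * c ^ 4 / (1 + c ^ 2) ^ 2 ≤ (Real.pi ^ 2 / 2 + 2) * c := by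
  have hpi := Real.pi_gt_d2
  have hpi2 := Real.pi_lt_d4
  rcases le_total c (1 / 2) with hc | hc
  · have ha := arctan_le_self h0.le
    have hb : 8 * c ^ 4 / (1 + c ^ 2) ^ 2 ≤ 0.64 * c := by
      rw [div_le_iff₀ (by positivity)]
      have : 8 * c ^ 3 ≤ 0.64 * (1 + c ^ 2) ^ 2 := by
        nlinarith [mul_nonneg h0.le (sub_nonneg.2 hc), sq_nonneg (c ^ 2 - 1 / 4),
          mul_nonneg (mul_nonneg h0.le h0.le) (sub_nonneg.2 hc), sq_nonneg (c - 1 / 2)]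
      nlinarith
    have : 2 * Real.pi * Real.arctan c ≤ 2 * Real.pi * c := by gcongr
    nlinarith [mul_pos h0 (show (0:ℝ) < Real.pi ^ 2 / 2 + 2 - 2 * Real.pi - 0.64 by nlinarith)]
  · let F : ℝ → ℝ := fun c => (Real.pi ^ 2 / 2 + 2) * c - 2 * Real.pi * Real.arctan c
      - 8 * c ^ 4 / (1 + c ^ 2) ^ 2
    have hd : ∀ x : ℝ, HasDerivAt F ((Real.pi ^ 2 / 2 + 2) * 1 - 2 * Real.pi * (1 / (1 + x ^ 2))
      - (8 * (4 * x ^ 3) * (1 + x ^ 2) ^ 2 - 8 * x ^ 4 * (2 * (1 + x ^ 2) * (2 * x))) /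
        ((1 + x ^ 2) ^ 2) ^ 2) x := by
      intro x
      have h1 : HasDerivAt (fun x : ℝ => 1 + x ^ 2) (2 * x) x := by
        simpa using (hasDerivAt_pow 2 x).const_add 1
      have h2 : HasDerivAt (fun x : ℝ => (1 + x ^ 2) ^ 2) (2 * (1 + x ^ 2) * (2 * x)) x := by
        simpa using h1.fun_pow 2
      have h4 : HasDerivAt (fun x : ℝ => 8 * x ^ 4) (8 * (4 * x ^ 3)) x := by
        simpa using (hasDerivAt_pow 4 x).const_mul 8
      exact (((hasDerivAt_id x).const_mul _).sub ((Real.hasDerivAt_arctan x).const_mul _)).sub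
        (h4.div h2 (by positivity))
    have hanti : AntitoneOn F (Set.Icc (1 / 2) 1) := by
      apply antitoneOn_of_deriv_nonpos (convex_Icc _ _)
        (fun x _ => (hd x).continuousAt.continuousWithinAt)
        (fun x _ => (hd x).differentiableAt.differentiableWithinAt)
      intro x hx
      rw [interior_Icc] at hx
      rw [(hd x).deriv]
      have e : (Real.pi ^ 2 / 2 + 2) * 1 - 2 * Real.pi * (1 / (1 + x ^ 2))
        - (8 * (4 * x ^ 3) * (1 + x ^ 2) ^ 2 - 8 * x ^ 4 * (2 * (1 + x ^ 2) * (2 * x))) /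
        ((1 + x ^ 2) ^ 2) ^ 2 = ((Real.pi ^ 2 / 2 + 2) * (1 + x ^ 2) ^ 3
          - 2 * Real.pi * (1 + x ^ 2) ^ 2 - 32 * x ^ 3) / (1 + x ^ 2) ^ 3 := by
        field_simp; ring
      rw [e]
      apply div_nonpos_of_nonpos_of_nonneg _ (by positivity)
      have hp := tix_poly_nonneg hx.1.le hx.2.le
      have hA : (Real.pi ^ 2 / 2 + 2) ≤ 6.9349 := by nlinarith
      have hB : (6.28 : ℝ) ≤ 2 * Real.pi := by linarith
      have := mul_le_mul_of_nonneg_right hA (show 0 ≤ (1 + x ^ 2) ^ 3 by positivity)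
      have := mul_le_mul_of_nonneg_right hB (show 0 ≤ (1 + x ^ 2) ^ 2 by positivity)
      linarith
    have h := hanti ⟨hc, h1.le⟩ ⟨by norm_num, le_rfl⟩ h1.le
    simp only [F, Real.arctan_one] at h
    nlinarith

/-- The constant in the inequality of Tix and Burenkov–Evans. -/
def tixConst : ℝ := (1 / 2) * (Real.pi / 2 + 2 / Real.pi)

/-- The Schur bound for the Coulomb kernel with weight `1 / (1 + p ^ 2)`. -/
def evenWt (p : ℝ) : ℝ := (p ^ 2 + 1) / p * Real.arctan p

/-- The Schur bound for the Coulomb kernel on odd functions. -/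
def oddWt (p : ℝ) : ℝ := 2 / Real.pi * p

theorem oddWt_nonneg {p : ℝ} (hp : 0 ≤ p) : 0 ≤ oddWt p := by
  have := Real.pi_pos
  unfold oddWt; positivity

theorem oddWt_le_evenWt {p : ℝ} (hp : 0 < p) : oddWt p ≤ evenWt p := by
  have := two_div_pi_mul_sq_le_arctan hp.le
  rw [oddWt, evenWt, div_mul_eq_mul_div (p ^ 2 + 1), le_div_iff₀ hp]
  nlinarith

theorem evenWt_add_le {p : ℝ} (hp : 0 < p) :
    evenWt p + (p / (√(1 + p ^ 2) + 1)) ^ 2 * oddWt p ≤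
      tixConst * √(1 + p ^ 2) * (1 + (p / (√(1 + p ^ 2) + 1)) ^ 2) := by
  set E := √(1 + p ^ 2) with hE
  have hE2 : E ^ 2 = 1 + p ^ 2 := Real.sq_sqrt (by positivity)
  have hE1 : 1 < E := by
    rw [hE]; apply Real.lt_sqrt_of_sq_lt; nlinarith
  set c := p / (E + 1) with hc
  have hc0 : 0 < c := by positivity
  have hpE : p = c * (E + 1) := by rw [hc]; field_simp
  have hc1 : c < 1 := by
    rw [hc, div_lt_one (by positivity)]; nlinarith
  have hcc : (1 + c ^ 2) = E * (1 - c ^ 2) := by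
    have : c ^ 2 * (E + 1) = E - 1 := by
      have h : (c * (E + 1)) ^ 2 = (E - 1) * (E + 1) := by rw [← hpE]; nlinarith
      have : (c ^ 2 * (E + 1)) * (E + 1) = (E - 1) * (E + 1) := by rw [← h]; ring
      exact mul_right_cancel₀ (by positivity) this
    nlinarith
  have hd : 0 < 1 - c ^ 2 := by nlinarith
  have hEc : E = (1 + c ^ 2) / (1 - c ^ 2) := by field_simp; linarith
  have hpc : p = 2 * c / (1 - c ^ 2) := by
    rw [hpE, hEc]; field_simp; ring
  have harc : Real.arctan p = 2 * Real.arctan c := by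
    rw [Real.two_mul_arctan (by linarith) hc1, hpc]
  have hpi := Real.pi_pos
  have key := tix_arctan_ineq hc0 hc1
  have hp2 : p ^ 2 + 1 = E ^ 2 := by linarith
  rw [evenWt, oddWt, tixConst, harc, hp2, hpc, hEc]
  have e1 : (((1 + c ^ 2) / (1 - c ^ 2)) ^ 2 / (2 * c / (1 - c ^ 2)) * (2 * Real.arctan c)
      + c ^ 2 * (2 / Real.pi * (2 * c / (1 - c ^ 2)))) =
      (2 * Real.pi * Real.arctan c + 8 * c ^ 4 / (1 + c ^ 2) ^ 2) *
        ((1 + c ^ 2) ^ 2 / (2 * Real.pi * c * (1 - c ^ 2))) := by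
    field_simp; ring
  have e2 : 1 / 2 * (Real.pi / 2 + 2 / Real.pi) * ((1 + c ^ 2) / (1 - c ^ 2)) * (1 + c ^ 2)
      = ((Real.pi ^ 2 / 2 + 2) * c) * ((1 + c ^ 2) ^ 2 / (2 * Real.pi * c * (1 - c ^ 2))) := by
    field_simp
  rw [e1, e2]
  gcongr

theorem lintegral_Ioi_of_hasDerivAt_of_nonneg {g g' : ℝ → ℝ} {l : ℝ}
    (hc : ContinuousWithinAt g (Set.Ici 0) 0) (hd : ∀ x ∈ Set.Ioi (0 : ℝ), HasDerivAt g (g' x) x)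
    (hp : ∀ x ∈ Set.Ioi (0 : ℝ), 0 ≤ g' x) (hl : Tendsto g atTop (𝓝 l)) :
    ∫⁻ x in Set.Ioi (0 : ℝ), ENNReal.ofReal (g' x) = ENNReal.ofReal (l - g 0) := by
  rw [← ofReal_integral_eq_lintegral_ofReal, integral_Ioi_of_hasDerivAt_of_nonneg hc hd hp hl]
  · exact integrableOn_Ioi_deriv_of_nonneg hc hd hp hl
  · exact (ae_restrict_iff' measurableSet_Ioi).2 (ae_of_all _ hp)

theorem lintegral_rpow_mul_exp_neg_mul_Ioi {a c : ℝ} (ha : 0 < a) (hc : 0 < c) :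
    ∫⁻ t in Set.Ioi (0 : ℝ), ENNReal.ofReal (t ^ (a - 1) * Real.exp (-(c * t))) =
      ENNReal.ofReal ((1 / c) ^ a * Real.Gamma a) := by
  have h := Real.integral_rpow_mul_exp_neg_mul_Ioi ha hc
  have hpos : 0 < (1 / c) ^ a * Real.Gamma a := mul_pos (by positivity) (Real.Gamma_pos_of_pos ha)
  rw [← h, ofReal_integral_eq_lintegral_ofReal]
  · by_contra hi
    rw [integral_undef hi] at h
    exact hpos.ne h
  · refine (ae_restrict_iff' measurableSet_Ioi).2 (ae_of_all _ fun t ht => ?_)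
    have : (0 : ℝ) < t := ht
    simp only [Pi.zero_apply]; positivity

theorem lintegral_exp_neg_mul_Ioi {c : ℝ} (hc : 0 < c) :
    ∫⁻ t in Set.Ioi (0 : ℝ), ENNReal.ofReal (Real.exp (-(c * t))) = ENNReal.ofReal (1 / c) := by
  simpa using lintegral_rpow_mul_exp_neg_mul_Ioi one_pos hc

theorem lintegral_inv_sqrt_mul_exp_neg_mul_Ioi {c : ℝ} (hc : 0 < c) :
    ∫⁻ t in Set.Ioi (0 : ℝ), ENNReal.ofReal ((√t)⁻¹ * Real.exp (-(c * t))) =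
      ENNReal.ofReal (√(Real.pi / c)) := by
  have h := lintegral_rpow_mul_exp_neg_mul_Ioi (a := 1 / 2) (by norm_num) hc
  rw [Real.Gamma_one_half_eq, ← Real.sqrt_eq_rpow, ← Real.sqrt_mul (by positivity)] at h
  rw [show Real.pi / c = 1 / c * Real.pi by ring, ← h]
  refine setLIntegral_congr_fun measurableSet_Ioi fun t ht => ?_
  have ht : (0 : ℝ) < t := ht
  rw [Real.sqrt_eq_rpow, ← Real.rpow_neg ht.le]
  norm_num

theorem lintegral_sqrt_mul_exp_neg_mul_Ioi {c : ℝ} (hc : 0 < c) :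
    ∫⁻ t in Set.Ioi (0 : ℝ), ENNReal.ofReal (√t * Real.exp (-(c * t))) =
      ENNReal.ofReal (√(Real.pi / c) / (2 * c)) := by
  have h := lintegral_rpow_mul_exp_neg_mul_Ioi (a := 1 / 2 + 1) (by norm_num) hc
  rw [Real.Gamma_add_one (by norm_num), Real.Gamma_one_half_eq, Real.rpow_add_one (by positivity),
    ← Real.sqrt_eq_rpow] at h
  rw [show √(Real.pi / c) / (2 * c) = √(1 / c) * (1 / c) * (1 / 2 * √Real.pi) by
    rw [show Real.pi / c = 1 / c * Real.pi by ring, Real.sqrt_mul (by positivity)]; ring, ← h]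
  refine setLIntegral_congr_fun measurableSet_Ioi fun t ht => ?_
  rw [Real.sqrt_eq_rpow]
  norm_num

theorem tendsto_div_add_atTop (b : ℝ) : Tendsto (fun z : ℝ => z / (z + b)) atTop (𝓝 1) := by
  have h : Tendsto (fun z : ℝ => 1 - b / (z + b)) atTop (𝓝 (1 - 0)) :=
    ((tendsto_const_nhds (x := b)).div_atTop (tendsto_atTop_add_const_right _ b tendsto_id)).const_sub 1
  rw [sub_zero] at h
  refine h.congr' ?_
  filter_upwards [eventually_gt_atTop (-b)] with z hz
  have : z + b ≠ 0 := by linarith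
  field_simp; ring

theorem hasDerivAt_sqrt_div_add {b z : ℝ} (hb : 0 < b) (hz : 0 < z) :
    HasDerivAt (fun z : ℝ => √(z / (z + b))) (b / (2 * √z * (z + b) * √(z + b))) z := by
  have h1 : HasDerivAt (fun z : ℝ => z / (z + b)) ((1 * (z + b) - z * 1) / (z + b) ^ 2) z :=
    (hasDerivAt_id z).div ((hasDerivAt_id z).add_const b) (show z + b ≠ 0 by positivity)
  refine (h1.sqrt (by positivity)).congr_deriv ?_
  have e : (√(z + b)) ^ 2 = z + b := Real.sq_sqrt (by positivity)
  have hs : 0 < √(z + b) := by positivity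
  have hs2 : 0 < √z := by positivity
  rw [Real.sqrt_div hz.le, div_div, eq_comm, div_eq_div_iff (by positivity) (by positivity)]
  field_simp
  rw [e]; ring

theorem lintegral_inv_sqrt_mul_inv_one_add_mul_sqrt :
    ∫⁻ z in Set.Ioi (0 : ℝ), ENNReal.ofReal (1 / (√z * (z + 1) * √(z + 1))) = 2 := by
  rw [lintegral_Ioi_of_hasDerivAt_of_nonneg (g := fun z => 2 * √(z / (z + 1))) (l := 2 * √1)]
  · norm_num
  · refine ContinuousAt.continuousWithinAt ?_
    refine (Real.continuous_sqrt.continuousAt.comp (ContinuousAt.div ?_ ?_ ?_)).const_mul 2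
    · fun_prop
    · fun_prop
    · norm_num
  · intro z hz
    refine ((hasDerivAt_sqrt_div_add one_pos hz).const_mul 2).congr_deriv ?_
    have hz : (0 : ℝ) < z := hz
    have : 0 < √z := by positivity
    field_simp
  · intro z hz
    have hz : (0 : ℝ) < z := hz
    positivity
  · exact ((tendsto_div_add_atTop 1).sqrt).const_mul 2

theorem lintegral_inv_sqrt_mul_inv_one_add_mul_inv_sqrt {p : ℝ} (hp : 0 < p) :
    ∫⁻ z in Set.Ioi (0 : ℝ), ENNReal.ofReal (1 / (√z * (z + 1) * √(z + (1 + p ^ 2)))) =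
      ENNReal.ofReal (2 / p * Real.arctan p) := by
  rw [lintegral_Ioi_of_hasDerivAt_of_nonneg
    (g := fun z => 2 / p * Real.arctan (p * √(z / (z + (1 + p ^ 2)))))
    (l := 2 / p * Real.arctan (p * √1))]
  · norm_num
  · refine ContinuousAt.continuousWithinAt ?_
    refine (Real.continuous_arctan.continuousAt.comp
      ((Real.continuous_sqrt.continuousAt.comp (ContinuousAt.div ?_ ?_ ?_)).const_mul p)).const_mul _
    · fun_prop
    · fun_prop
    · positivity
  · intro z hz
    have hb : 0 < 1 + p ^ 2 := by positivity
    have hz : (0 : ℝ) < z := hz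
    refine ((((hasDerivAt_sqrt_div_add hb hz).const_mul p).arctan).const_mul (2 / p)).congr_deriv ?_
    have : 0 < √z := by positivity
    have : 0 < √(z + (1 + p ^ 2)) := by positivity
    rw [mul_pow, Real.sq_sqrt (by positivity)]
    field_simp
    ring
  · intro z hz
    have hz : (0 : ℝ) < z := hz
    positivity
  · exact ((Real.continuous_arctan.tendsto _).comp
      (((tendsto_div_add_atTop _).sqrt).const_mul p)).const_mul _

theorem lintegral_Ioi_comp_div {t : ℝ} (ht : 0 < t) (F : ℝ → ENNReal) :
    ∫⁻ s in Set.Ioi (0 : ℝ), F s = ∫⁻ z in Set.Ioi (0 : ℝ), ENNReal.ofReal t⁻¹ * F (z / t) := by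
  have h := lintegral_image_eq_lintegral_abs_deriv_mul (s := Set.Ioi (0 : ℝ)) measurableSet_Ioi
    (f := fun z => z / t) (f' := fun _ => t⁻¹)
    (fun z _ => by simpa using ((hasDerivAt_id z).div_const t).hasDerivWithinAt)
    (fun a _ b _ hab => by simpa [ht.ne'] using hab) F
  have himg : (fun z : ℝ => z / t) '' Set.Ioi 0 = Set.Ioi 0 := by
    ext y
    simp only [Set.mem_image, Set.mem_Ioi]
    constructor
    · rintro ⟨z, hz, rfl⟩; positivity
    · intro hy; exact ⟨y * t, by positivity, by field_simp⟩
  rw [himg] at h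
  rw [h, abs_of_pos (inv_pos.2 ht)]

theorem lintegral_coulomb {r : ℝ} (hr : 0 < r) :
    ∫⁻ s in Set.Ioi (0 : ℝ), ENNReal.ofReal ((√s)⁻¹ * Real.exp (-(Real.pi * r ^ 2 * s))) =
      ENNReal.ofReal (1 / r) := by
  have := Real.pi_pos
  rw [lintegral_inv_sqrt_mul_exp_neg_mul_Ioi (by positivity)]
  congr 1
  rw [show Real.pi / (Real.pi * r ^ 2) = (1 / r) ^ 2 by field_simp, Real.sqrt_sq (by positivity)]

/-- The reflection of the `i`-th coordinate of `ℝ³`. -/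
def coordRefl (i : Fin 3) : V3 ≃ₗᵢ[ℝ] V3 :=
  LinearIsometryEquiv.piLpCongrRight 2
    fun j => if j = i then LinearIsometryEquiv.neg ℝ else LinearIsometryEquiv.refl ℝ ℝ

theorem coordRefl_apply (i j : Fin 3) (x : V3) :
    coordRefl i x j = if j = i then -x j else x j := by
  simp only [coordRefl, LinearIsometryEquiv.piLpCongrRight_apply]
  split_ifs <;> simp

theorem coordRefl_coordRefl (i : Fin 3) (x : V3) : coordRefl i (coordRefl i x) = x := by
  ext j
  simp only [coordRefl_apply]
  split_ifs <;> simp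

theorem coordRefl_comm (i j : Fin 3) (x : V3) :
    coordRefl i (coordRefl j x) = coordRefl j (coordRefl i x) := by
  ext k
  simp only [coordRefl_apply]
  split_ifs <;> simp

theorem coordRefl_coordRefl_coordRefl (x : V3) :
    coordRefl 0 (coordRefl 1 (coordRefl 2 x)) = -x := by
  ext k
  simp only [coordRefl_apply]
  fin_cases k <;> simp

theorem inner_coordRefl_left (i : Fin 3) (x y : V3) :
    inner ℝ (coordRefl i x) y = inner ℝ x y - 2 * (x i * y i) := by
  simp only [PiLp.inner_apply, Fin.sum_univ_three, coordRefl_apply]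
  fin_cases i <;> simp <;> ring

theorem inner_coordRefl_right (i : Fin 3) (x y : V3) :
    inner ℝ x (coordRefl i y) = inner ℝ x y - 2 * (x i * y i) := by
  rw [← real_inner_comm x, inner_coordRefl_left, ← real_inner_comm x y]
  ring

theorem measurePreserving_coordRefl (i : Fin 3) :
    MeasurePreserving (coordRefl i) (volume : Measure V3) volume :=
  (coordRefl i).measurePreserving

/-- The heat kernel, the Fourier transform of `x ↦ exp (-π s ‖x‖²)`. -/
def heatKer (s : ℝ) (ζ : V3) : ℝ := (√s)⁻¹ ^ 3 * Real.exp (-(Real.pi / s * ‖ζ‖ ^ 2))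

theorem heatKer_nonneg (s : ℝ) (ζ : V3) : 0 ≤ heatKer s ζ := by unfold heatKer; positivity

theorem heatKer_sub_comm (s : ℝ) (ξ η : V3) : heatKer s (ξ - η) = heatKer s (η - ξ) := by
  simp only [heatKer, norm_sub_rev]

@[fun_prop]
theorem continuous_heatKer (s : ℝ) : Continuous (heatKer s) := by
  unfold heatKer; fun_prop

theorem heatKer_sub_coordRefl (s : ℝ) (i : Fin 3) (ξ η : V3) :
    heatKer s (coordRefl i ξ - coordRefl i η) = heatKer s (ξ - η) := by
  simp only [heatKer, ← map_sub, LinearIsometryEquiv.norm_map]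

theorem heatKer_sub_coordRefl_right (s : ℝ) (i : Fin 3) (ξ η : V3) :
    heatKer s (coordRefl i ξ - η) = heatKer s (ξ - coordRefl i η) := by
  rw [← heatKer_sub_coordRefl s i ξ, coordRefl_coordRefl]

theorem integral_exp_neg_mul_sq_norm {b : ℝ} (hb : 0 < b) :
    ∫ v : V3, Real.exp (-b * ‖v‖ ^ 2) = √(Real.pi / b) ^ 3 := by
  rw [GaussianFourier.integral_rexp_neg_mul_sq_norm hb, finrank_euclideanSpace_fin,
    Real.sqrt_eq_rpow, ← Real.rpow_natCast, ← Real.rpow_mul (by have := Real.pi_pos; positivity)]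
  norm_num

theorem integrable_exp_neg_mul_sq_norm {b : ℝ} (hb : 0 < b) :
    Integrable fun v : V3 => Real.exp (-b * ‖v‖ ^ 2) := by
  by_contra hi
  have h := integral_exp_neg_mul_sq_norm hb
  rw [integral_undef hi] at h
  have := Real.pi_pos
  have : 0 < √(Real.pi / b) ^ 3 := by positivity
  exact this.ne h

theorem integrable_coord_mul_exp_neg_mul_sq_norm {b : ℝ} (hb : 0 < b) (i : Fin 3) :
    Integrable fun v : V3 => v i * Real.exp (-b * ‖v‖ ^ 2) := by
  refine ((integrable_exp_neg_mul_sq_norm (half_pos hb)).const_mul (1 + 2 / b)).mono'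
    (by fun_prop) (ae_of_all _ fun v => ?_)
  have h1 : |v i| ≤ ‖v‖ := by simpa using PiLp.norm_apply_le v i
  have h2 : ‖v‖ ≤ (1 + 2 / b) * Real.exp (b / 2 * ‖v‖ ^ 2) := by
    have h3 := Real.add_one_le_exp (b / 2 * ‖v‖ ^ 2)
    have h4 : 1 + ‖v‖ ^ 2 ≤ (1 + 2 / b) * (b / 2 * ‖v‖ ^ 2 + 1) := by
      have : (1 + 2 / b) * (b / 2 * ‖v‖ ^ 2 + 1)
        = 1 + ‖v‖ ^ 2 + (2 / b + b / 2 * ‖v‖ ^ 2) := by field_simp; ring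
      rw [this]
      have : 0 ≤ 2 / b + b / 2 * ‖v‖ ^ 2 := by positivity
      linarith
    have h5 := mul_le_mul_of_nonneg_left h3 (show 0 ≤ 1 + 2 / b by positivity)
    nlinarith [sq_nonneg (‖v‖ - 1)]
  have h6 : Real.exp (-b * ‖v‖ ^ 2) =
      Real.exp (-(b / 2) * ‖v‖ ^ 2) * Real.exp (-(b / 2 * ‖v‖ ^ 2)) := by
    rw [← Real.exp_add]; ring_nf
  rw [norm_mul, Real.norm_eq_abs, Real.norm_of_nonneg (Real.exp_nonneg _), h6]
  have h7 : |v i| * Real.exp (-(b / 2 * ‖v‖ ^ 2)) ≤ 1 + 2 / b := by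
    rw [Real.exp_neg, ← div_eq_mul_inv, div_le_iff₀ (Real.exp_pos _)]
    exact h1.trans h2
  calc _ = (|v i| * Real.exp (-(b / 2 * ‖v‖ ^ 2))) * Real.exp (-(b / 2) * ‖v‖ ^ 2) := by ring
    _ ≤ _ := by gcongr

theorem exp_mul_heatKer_eq {s t : ℝ} (hs : 0 < s) (ht : 0 < t) (ξ η : V3) :
    Real.exp (-(Real.pi * t * ‖η‖ ^ 2)) * heatKer s (ξ - η) =
      (√s)⁻¹ ^ 3 * Real.exp (-(Real.pi * t * ‖ξ‖ ^ 2 / (1 + t * s))) *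
        Real.exp (-(Real.pi * (1 + t * s) / s) * ‖η - (1 + t * s)⁻¹ • ξ‖ ^ 2) := by
  have h0 : 0 < 1 + t * s := by positivity
  rw [heatKer, mul_left_comm, ← Real.exp_add, mul_assoc ((√s)⁻¹ ^ 3), ← Real.exp_add]
  congr 2
  rw [norm_sub_sq_real, norm_sub_sq_real, inner_smul_right, norm_smul, real_inner_comm,
    Real.norm_of_nonneg (by positivity)]
  field_simp
  ring

theorem sqrt_inv_pow_mul {s t : ℝ} (hs : 0 < s) (ht : 0 < t) :
    (√s)⁻¹ ^ 3 * √(Real.pi / (Real.pi * (1 + t * s) / s)) ^ 3 = (√(1 + t * s))⁻¹ ^ 3 := by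
  have := Real.pi_pos
  have h : Real.pi / (Real.pi * (1 + t * s) / s) = s / (1 + t * s) := by field_simp
  rw [h, Real.sqrt_div hs.le, ← mul_pow]
  congr 1
  have : 0 < √s := by positivity
  field_simp

theorem integrable_exp_mul_heatKer {s t : ℝ} (hs : 0 < s) (ht : 0 < t) (ξ : V3) :
    Integrable fun η : V3 => Real.exp (-(Real.pi * t * ‖η‖ ^ 2)) * heatKer s (ξ - η) := by
  have := Real.pi_pos
  simp only [exp_mul_heatKer_eq hs ht]
  exact (((integrable_exp_neg_mul_sq_norm (by positivity)).comp_sub_right _).const_mul _)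

theorem integral_exp_mul_heatKer {s t : ℝ} (hs : 0 < s) (ht : 0 < t) (ξ : V3) :
    ∫ η : V3, Real.exp (-(Real.pi * t * ‖η‖ ^ 2)) * heatKer s (ξ - η) =
      (√(1 + t * s))⁻¹ ^ 3 * Real.exp (-(Real.pi * t * ‖ξ‖ ^ 2 / (1 + t * s))) := by
  have := Real.pi_pos
  simp only [exp_mul_heatKer_eq hs ht]
  rw [integral_const_mul, integral_sub_right_eq_self
    (fun v : V3 => Real.exp (-(Real.pi * (1 + t * s) / s) * ‖v‖ ^ 2)),
    integral_exp_neg_mul_sq_norm (by positivity), ← sqrt_inv_pow_mul hs ht]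
  ring

theorem integrable_coord_mul_exp_mul_heatKer {s t : ℝ} (hs : 0 < s) (ht : 0 < t) (i : Fin 3)
    (ξ : V3) :
    Integrable fun η : V3 => η i * (Real.exp (-(Real.pi * t * ‖η‖ ^ 2)) * heatKer s (ξ - η)) := by
  have := Real.pi_pos
  have hb : 0 < Real.pi * (1 + t * s) / s := by positivity
  have h : Integrable fun v : V3 => (v + (1 + t * s)⁻¹ • ξ) i *
      Real.exp (-(Real.pi * (1 + t * s) / s) * ‖v‖ ^ 2) := by
    simp only [PiLp.add_apply, add_mul]
    exact (integrable_coord_mul_exp_neg_mul_sq_norm hb i).add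
      ((integrable_exp_neg_mul_sq_norm hb).const_mul _)
  refine ((h.comp_sub_right ((1 + t * s)⁻¹ • ξ)).const_mul ((√s)⁻¹ ^ 3 *
    Real.exp (-(Real.pi * t * ‖ξ‖ ^ 2 / (1 + t * s))))).congr (ae_of_all _ fun η => ?_)
  simp only [exp_mul_heatKer_eq hs ht, sub_add_cancel]
  ring

theorem integral_coord_mul_exp_mul_heatKer {s t : ℝ} (hs : 0 < s) (ht : 0 < t) (i : Fin 3)
    (ξ : V3) :
    ∫ η : V3, η i * (Real.exp (-(Real.pi * t * ‖η‖ ^ 2)) * heatKer s (ξ - η)) =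
      ξ i * ((√(1 + t * s))⁻¹ ^ 5 * Real.exp (-(Real.pi * t * ‖ξ‖ ^ 2 / (1 + t * s)))) := by
  have := Real.pi_pos
  have hb : 0 < Real.pi * (1 + t * s) / s := by positivity
  have h1 : ∀ η : V3, η i * (Real.exp (-(Real.pi * t * ‖η‖ ^ 2)) * heatKer s (ξ - η)) =
      (√s)⁻¹ ^ 3 * Real.exp (-(Real.pi * t * ‖ξ‖ ^ 2 / (1 + t * s))) *
      (((η - (1 + t * s)⁻¹ • ξ) + (1 + t * s)⁻¹ • ξ) i *
        Real.exp (-(Real.pi * (1 + t * s) / s) * ‖η - (1 + t * s)⁻¹ • ξ‖ ^ 2)) := by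
    intro η
    rw [exp_mul_heatKer_eq hs ht, sub_add_cancel]
    ring
  have h0 : ∫ v : V3, v i * Real.exp (-(Real.pi * (1 + t * s) / s) * ‖v‖ ^ 2) = 0 := by
    have h := integral_neg_eq_self
      (fun v : V3 => v i * Real.exp (-(Real.pi * (1 + t * s) / s) * ‖v‖ ^ 2)) volume
    have h' : ∀ v : V3, (-v) i * Real.exp (-(Real.pi * (1 + t * s) / s) * ‖-v‖ ^ 2) =
        -(v i * Real.exp (-(Real.pi * (1 + t * s) / s) * ‖v‖ ^ 2)) := by
      intro v
      rw [PiLp.neg_apply, norm_neg, neg_mul (v i)]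
    simp only [h', integral_neg] at h
    linarith
  simp only [h1]
  rw [integral_const_mul, integral_sub_right_eq_self
    (fun v : V3 => (v + (1 + t * s)⁻¹ • ξ) i *
      Real.exp (-(Real.pi * (1 + t * s) / s) * ‖v‖ ^ 2))]
  simp only [PiLp.add_apply, add_mul]
  rw [integral_add (integrable_coord_mul_exp_neg_mul_sq_norm hb i)
      ((integrable_exp_neg_mul_sq_norm hb).const_mul _), h0, integral_const_mul,
    integral_exp_neg_mul_sq_norm hb, zero_add]
  have h2 : (1 + t * s)⁻¹ = (√(1 + t * s))⁻¹ ^ 2 := by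
    rw [inv_pow, Real.sq_sqrt (by positivity)]
  rw [PiLp.smul_apply, smul_eq_mul, h2]
  linear_combination ξ i * (√(1 + t * s))⁻¹ ^ 2 *
    Real.exp (-(Real.pi * t * ‖ξ‖ ^ 2 / (1 + t * s))) * sqrt_inv_pow_mul hs ht

/-- The kernel of the heat semigroup on functions which are odd in the `i`-th variable. -/
def oddKer (i : Fin 3) (s : ℝ) (ξ η : V3) : ℝ :=
  |heatKer s (ξ - η) - heatKer s (ξ - coordRefl i η)| / 2

theorem coord_mul_oddKer {s : ℝ} (hs : 0 < s) (i : Fin 3) (ξ η : V3) :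
    |η i| * oddKer i s ξ η =
      SignType.sign (ξ i) * (η i * ((heatKer s (ξ - η) - heatKer s (ξ - coordRefl i η)) / 2)) := by
  have hsgn : ∀ ξ η : V3, 0 ≤ ξ i * η i → heatKer s (ξ - coordRefl i η) ≤ heatKer s (ξ - η) := by
    intro ξ η h
    have := Real.pi_pos
    unfold heatKer
    gcongr 2
    rw [neg_le_neg_iff]
    gcongr ?_ * ?_
    rw [norm_sub_sq_real, norm_sub_sq_real, LinearIsometryEquiv.norm_map,
      inner_coordRefl_right]
    linarith
  have hsgn' : ∀ ξ η : V3, ξ i * η i ≤ 0 → heatKer s (ξ - η) ≤ heatKer s (ξ - coordRefl i η) := by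
    intro ξ η h
    have := hsgn ξ (coordRefl i η) (by rw [coordRefl_apply, if_pos rfl]; linarith)
    rwa [coordRefl_coordRefl] at this
  rw [oddKer]
  rcases lt_trichotomy (ξ i) 0 with h | h | h
  · rw [sign_neg h]
    rcases le_total 0 (η i) with h' | h'
    · rw [abs_of_nonneg h', abs_of_nonpos (sub_nonpos.2 (hsgn' _ _ (by nlinarith)))]
      simp only [SignType.coe_neg_one]; ring
    · rw [abs_of_nonpos h', abs_of_nonneg (sub_nonneg.2 (hsgn _ _ (by nlinarith)))]
      simp only [SignType.coe_neg_one]; ring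
  · have h2 : heatKer s (ξ - coordRefl i η) = heatKer s (ξ - η) :=
      le_antisymm (hsgn _ _ (by simp [h])) (hsgn' _ _ (by simp [h]))
    simp [h2]
  · rw [sign_pos h]
    rcases le_total 0 (η i) with h' | h'
    · rw [abs_of_nonneg h', abs_of_nonneg (sub_nonneg.2 (hsgn _ _ (by nlinarith)))]
      simp only [SignType.coe_one]; ring
    · rw [abs_of_nonpos h', abs_of_nonpos (sub_nonpos.2 (hsgn' _ _ (by nlinarith)))]
      simp only [SignType.coe_one]; ring

theorem oddKer_nonneg (i : Fin 3) (s : ℝ) (ξ η : V3) : 0 ≤ oddKer i s ξ η := by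
  unfold oddKer; positivity

theorem oddKer_comm (i : Fin 3) (s : ℝ) (ξ η : V3) : oddKer i s ξ η = oddKer i s η ξ := by
  rw [oddKer, oddKer, heatKer_sub_comm, heatKer_sub_comm s ξ, heatKer_sub_coordRefl_right]

theorem lintegral_exp_mul_heatKer {s t : ℝ} (hs : 0 < s) (ht : 0 < t) (ξ : V3) :
    ∫⁻ η : V3, ENNReal.ofReal (Real.exp (-(Real.pi * t * ‖η‖ ^ 2)) * heatKer s (ξ - η)) =
      ENNReal.ofReal ((√(1 + t * s))⁻¹ ^ 3 *
        Real.exp (-(Real.pi * t * ‖ξ‖ ^ 2 / (1 + t * s)))) := by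
  rw [← integral_exp_mul_heatKer hs ht,
    ofReal_integral_eq_lintegral_ofReal (integrable_exp_mul_heatKer hs ht ξ)]
  exact ae_of_all _ fun η => mul_nonneg (Real.exp_nonneg _) (heatKer_nonneg _ _)

theorem lintegral_coord_mul_exp_mul_oddKer {s t : ℝ} (hs : 0 < s) (ht : 0 < t) (i : Fin 3)
    (ξ : V3) :
    ∫⁻ η : V3, ENNReal.ofReal (|η i| * Real.exp (-(Real.pi * t * ‖η‖ ^ 2)) * oddKer i s ξ η) =
      ENNReal.ofReal (|ξ i| * ((√(1 + t * s))⁻¹ ^ 5 *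
        Real.exp (-(Real.pi * t * ‖ξ‖ ^ 2 / (1 + t * s))))) := by
  have h1 : ∀ η : V3, |η i| * Real.exp (-(Real.pi * t * ‖η‖ ^ 2)) * oddKer i s ξ η =
      SignType.sign (ξ i) / 2 *
        (η i * (Real.exp (-(Real.pi * t * ‖η‖ ^ 2)) * heatKer s (ξ - η)) +
        (coordRefl i η) i * (Real.exp (-(Real.pi * t * ‖coordRefl i η‖ ^ 2)) *
          heatKer s (ξ - coordRefl i η))) := by
    intro η
    rw [mul_right_comm, coord_mul_oddKer hs, LinearIsometryEquiv.norm_map, coordRefl_apply,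
      if_pos rfl]
    ring
  have hi := integrable_coord_mul_exp_mul_heatKer hs ht i ξ
  have hi2 : Integrable fun η : V3 => (coordRefl i η) i *
      (Real.exp (-(Real.pi * t * ‖coordRefl i η‖ ^ 2)) * heatKer s (ξ - coordRefl i η)) :=
    ((measurePreserving_coordRefl i).integrable_comp_emb
      (coordRefl i).toHomeomorph.measurableEmbedding).2 hi
  have hI2 := (measurePreserving_coordRefl i).integral_comp
    (coordRefl i).toHomeomorph.measurableEmbedding
    (fun η : V3 => η i * (Real.exp (-(Real.pi * t * ‖η‖ ^ 2)) * heatKer s (ξ - η)))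
  have h2 : ∫ η : V3, |η i| * Real.exp (-(Real.pi * t * ‖η‖ ^ 2)) * oddKer i s ξ η =
      |ξ i| * ((√(1 + t * s))⁻¹ ^ 5 * Real.exp (-(Real.pi * t * ‖ξ‖ ^ 2 / (1 + t * s)))) := by
    simp only [h1]
    rw [integral_const_mul, integral_add hi hi2, hI2, integral_coord_mul_exp_mul_heatKer hs ht,
      ← sign_mul_self (ξ i)]
    ring
  rw [← h2, ofReal_integral_eq_lintegral_ofReal]
  · simp only [h1]
    exact (hi.add hi2).const_mul _
  · exact ae_of_all _ fun η => mul_nonneg (by positivity) (oddKer_nonneg _ _ _ _)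

theorem ennreal_two_mul_mul_le (x y : ENNReal) {u v : ENNReal} (hu : u ≠ 0) (hu' : u ≠ ⊤)
    (hv : v ≠ 0) (hv' : v ≠ ⊤) :
    2 * (x * y) ≤ x ^ 2 * (u⁻¹ * v) + y ^ 2 * (v⁻¹ * u) := by
  have h1 : u⁻¹ * v ≠ 0 := mul_ne_zero (ENNReal.inv_ne_zero.2 hu') hv
  have h2 : v⁻¹ * u ≠ 0 := mul_ne_zero (ENNReal.inv_ne_zero.2 hv') hu
  by_cases hx : x = ⊤
  · rw [hx, ENNReal.top_pow two_ne_zero, ENNReal.top_mul h1, top_add]; exact le_top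
  by_cases hy : y = ⊤
  · rw [hy, ENNReal.top_pow two_ne_zero, ENNReal.top_mul h2, add_top]; exact le_top
  lift x to NNReal using hx
  lift y to NNReal using hy
  lift u to NNReal using hu'
  lift v to NNReal using hv'
  have hu0 : u ≠ 0 := by simpa using hu
  have hv0 : v ≠ 0 := by simpa using hv
  rw [← ENNReal.coe_inv hu0, ← ENNReal.coe_inv hv0]
  norm_cast
  have hu1 : (0 : ℝ) < u := by positivity
  have hv1 : (0 : ℝ) < v := by positivity
  rw [← NNReal.coe_le_coe]
  push_cast
  rw [← sub_nonneg]
  have : (x : ℝ) ^ 2 * ((u : ℝ)⁻¹ * v) + y ^ 2 * ((v : ℝ)⁻¹ * u) - 2 * (x * y) =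
      (u * v : ℝ)⁻¹ * (x * v - y * u) ^ 2 := by
    field_simp; ring
  rw [this]; positivity

section Schur

variable {α : Type*} [MeasurableSpace α] {μ : Measure α} [SFinite μ]

/-- The Schur test for a symmetric kernel. -/
theorem lintegral_lintegral_mul_mul_le_of_symm {a h : α → ENNReal} {k : α → α → ENNReal}
    (ha : Measurable a) (hh : Measurable h) (hk : Measurable (Function.uncurry k))
    (hsymm : ∀ x y, k x y = k y x) (h0 : ∀ᵐ x ∂μ, h x ≠ 0) (h1 : ∀ᵐ x ∂μ, h x ≠ ⊤) :
    ∫⁻ x, ∫⁻ y, a x * a y * k x y ∂μ ∂μ ≤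
      ∫⁻ x, a x ^ 2 * (h x)⁻¹ * ∫⁻ y, h y * k x y ∂μ ∂μ := by
  set F : α → α → ENNReal := fun x y => a x ^ 2 * ((h x)⁻¹ * h y) * k x y with hF
  have hFm : Measurable (Function.uncurry F) := by
    have := hk
    simp only [hF, Function.uncurry_def] at this ⊢
    fun_prop
  have e1 : ∫⁻ x, ∫⁻ y, F x y ∂μ ∂μ = ∫⁻ x, a x ^ 2 * (h x)⁻¹ * ∫⁻ y, h y * k x y ∂μ ∂μ := by
    refine lintegral_congr fun x => ?_
    rw [← lintegral_const_mul]
    · refine lintegral_congr fun y => ?_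
      simp only [hF]; ring
    · have := hk.of_uncurry_left (x := x)
      fun_prop
  have e2 : ∫⁻ x, ∫⁻ y, F y x ∂μ ∂μ = ∫⁻ x, ∫⁻ y, F x y ∂μ ∂μ :=
    (lintegral_lintegral_swap hFm.aemeasurable).symm
  have hle : 2 * ∫⁻ x, ∫⁻ y, a x * a y * k x y ∂μ ∂μ ≤ 2 * ∫⁻ x, ∫⁻ y, F x y ∂μ ∂μ := by
    conv_rhs => rw [two_mul, ← e2]
    rw [e2]
    conv_rhs => enter [2]; rw [← e2]
    rw [← lintegral_add_left (by exact Measurable.lintegral_prod_right' hFm),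
      ← lintegral_const_mul' _ _ (by simp)]
    refine lintegral_mono_ae ?_
    filter_upwards [h0, h1] with x hx0 hx1
    rw [← lintegral_add_left (hFm.of_uncurry_left (x := x)), ← lintegral_const_mul' _ _ (by simp)]
    refine lintegral_mono_ae ?_
    filter_upwards [h0, h1] with y hy0 hy1
    simp only [hF]
    rw [hsymm y x, ← add_mul, ← mul_assoc]
    gcongr
    exact ennreal_two_mul_mul_le _ _ hx0 hx1 hy0 hy1
  rw [← e1]
  exact (ENNReal.mul_le_mul_iff_right (by simp) (by simp)).1 hle

end Schur

/-- A bound on the Coulomb energy obtained by applying the Schur test to a family of kernels. -/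
theorem lintegral_coulomb_le_of_schur {q a h S : V3 → ENNReal} {k : ℝ → V3 → V3 → ENNReal}
    (hq : Measurable q) (ha : Measurable a) (hh : Measurable h)
    (hk : Measurable fun p : ℝ × V3 × V3 => k p.1 p.2.1 p.2.2)
    (hsymm : ∀ s x y, k s x y = k s y x) (h0 : ∀ᵐ x, h x ≠ 0) (h1 : ∀ᵐ x, h x ≠ ⊤)
    (hle : ∀ s, 0 < s → ∫⁻ x, q x * ENNReal.ofReal (Real.exp (-(Real.pi * ‖x‖ ^ 2 * s))) ≤
      ∫⁻ x, ∫⁻ y, a x * a y * k s x y)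
    (hS : ∀ᵐ x, ∫⁻ s in Set.Ioi (0 : ℝ), ENNReal.ofReal (√s)⁻¹ * ∫⁻ y, h y * k s x y ≤
      S x * h x) :
    ∫⁻ x, q x * ENNReal.ofReal (1 / ‖x‖) ≤ ∫⁻ x, S x * a x ^ 2 := by
  have hks : ∀ s, Measurable (Function.uncurry (k s)) := fun s =>
    hk.comp (measurable_const.prodMk measurable_id)
  have hinner : Measurable fun p : ℝ × V3 => ∫⁻ y, h y * k p.1 p.2 y := by
    refine Measurable.lintegral_prod_right'
      (f := fun p : (ℝ × V3) × V3 => h p.2 * k p.1.1 p.1.2 p.2) ?_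
    have : Measurable fun p : (ℝ × V3) × V3 => k p.1.1 p.1.2 p.2 :=
      hk.comp (measurable_fst.fst.prodMk (measurable_fst.snd.prodMk measurable_snd))
    fun_prop
  calc ∫⁻ x, q x * ENNReal.ofReal (1 / ‖x‖)
      = ∫⁻ x, ∫⁻ s in Set.Ioi (0 : ℝ), ENNReal.ofReal (√s)⁻¹ *
          (q x * ENNReal.ofReal (Real.exp (-(Real.pi * ‖x‖ ^ 2 * s)))) := by
        refine lintegral_congr_ae ?_
        filter_upwards [Measure.ae_ne volume (0 : V3)] with x hx
        rw [← lintegral_coulomb (norm_pos_iff.2 hx), ← lintegral_const_mul _ (by fun_prop)]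
        refine lintegral_congr fun s => ?_
        rw [ENNReal.ofReal_mul (by positivity)]
        ring
    _ = ∫⁻ s in Set.Ioi (0 : ℝ), ENNReal.ofReal (√s)⁻¹ *
          ∫⁻ x, (q x * ENNReal.ofReal (Real.exp (-(Real.pi * ‖x‖ ^ 2 * s)))) := by
        rw [lintegral_lintegral_swap (by simp only [Function.uncurry_def]; fun_prop)]
        refine lintegral_congr fun s => ?_
        rw [lintegral_const_mul' _ _ (by simp)]
    _ ≤ ∫⁻ s in Set.Ioi (0 : ℝ), ENNReal.ofReal (√s)⁻¹ *
          ∫⁻ x, a x ^ 2 * (h x)⁻¹ * ∫⁻ y, h y * k s x y := by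
        refine setLIntegral_mono' measurableSet_Ioi fun s hs => ?_
        exact mul_le_mul' le_rfl ((hle s hs).trans
          (lintegral_lintegral_mul_mul_le_of_symm ha hh (hks s) (hsymm s) h0 h1))
    _ = ∫⁻ x, a x ^ 2 * (h x)⁻¹ *
          ∫⁻ s in Set.Ioi (0 : ℝ), ENNReal.ofReal (√s)⁻¹ * ∫⁻ y, h y * k s x y := by
        rw [lintegral_congr fun s : ℝ => (lintegral_const_mul' (μ := (volume : Measure V3))
          (ENNReal.ofReal (√s)⁻¹) (fun x => a x ^ 2 * (h x)⁻¹ * ∫⁻ y, h y * k s x y)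
          ENNReal.ofReal_ne_top).symm, lintegral_lintegral_swap]
        · refine lintegral_congr fun x => ?_
          rw [← lintegral_const_mul]
          · refine lintegral_congr fun s => ?_
            ring
          · have : Measurable fun s => ∫⁻ y, h y * k s x y :=
              hinner.comp (measurable_id.prodMk measurable_const)
            fun_prop
        · simp only [Function.uncurry_def]
          fun_prop
    _ ≤ ∫⁻ x, S x * a x ^ 2 := by
        refine lintegral_mono_ae ?_
        filter_upwards [hS, h0, h1] with x hx hx0 hx1
        calc _ ≤ a x ^ 2 * (h x)⁻¹ * (S x * h x) := by gcongr
          _ = S x * a x ^ 2 * ((h x)⁻¹ * h x) := by ring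
          _ = _ := by rw [ENNReal.inv_mul_cancel hx0 hx1, mul_one]

theorem lintegral_inv_sqrt_mul_kernel {W : ℝ → ENNReal} {m : V3 → ENNReal}
    {k : ℝ → V3 → V3 → ENNReal} (hW : Measurable W) (hm : Measurable m)
    (hk : Measurable fun p : ℝ × V3 × V3 => k p.1 p.2.1 p.2.2) (n : ℕ) (ξ : V3)
    (hG : ∀ s t, 0 < s → 0 < t →
      ∫⁻ η, m η * ENNReal.ofReal (Real.exp (-(Real.pi * t * ‖η‖ ^ 2))) * k s ξ η =
        m ξ * ENNReal.ofReal ((√(1 + t * s))⁻¹ ^ n *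
          Real.exp (-(Real.pi * t * ‖ξ‖ ^ 2 / (1 + t * s))))) :
    ∫⁻ s in Set.Ioi (0 : ℝ), ENNReal.ofReal (√s)⁻¹ * ∫⁻ η, (m η * ∫⁻ t in Set.Ioi (0 : ℝ),
        W t * ENNReal.ofReal (Real.exp (-(Real.pi * t * ‖η‖ ^ 2)))) * k s ξ η =
      ∫⁻ z in Set.Ioi (0 : ℝ), m ξ * ENNReal.ofReal ((√z)⁻¹ * (√(1 + z))⁻¹ ^ n) *
        ∫⁻ t in Set.Ioi (0 : ℝ), W t * ENNReal.ofReal ((√t)⁻¹ *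
          Real.exp (-(Real.pi * t * ‖ξ‖ ^ 2 / (1 + z)))) := by
  have hk' : ∀ s, Measurable (k s ξ) := fun s =>
    hk.comp (measurable_const.prodMk (measurable_const.prodMk measurable_id))
  calc _ = ∫⁻ s in Set.Ioi (0 : ℝ), ∫⁻ t in Set.Ioi (0 : ℝ), ENNReal.ofReal (√s)⁻¹ *
          (W t * (m ξ * ENNReal.ofReal ((√(1 + t * s))⁻¹ ^ n *
          Real.exp (-(Real.pi * t * ‖ξ‖ ^ 2 / (1 + t * s)))))) := by
        refine setLIntegral_congr_fun measurableSet_Ioi fun s hs => ?_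
        rw [lintegral_const_mul _ (by fun_prop)]
        congr 1
        calc _ = ∫⁻ η, ∫⁻ t in Set.Ioi (0 : ℝ), W t *
              (m η * ENNReal.ofReal (Real.exp (-(Real.pi * t * ‖η‖ ^ 2))) * k s ξ η) := by
              refine lintegral_congr fun η => ?_
              rw [← lintegral_const_mul _ (by fun_prop), ← lintegral_mul_const _ (by fun_prop)]
              refine lintegral_congr fun t => ?_
              ring
          _ = ∫⁻ t in Set.Ioi (0 : ℝ), ∫⁻ η, W t *
              (m η * ENNReal.ofReal (Real.exp (-(Real.pi * t * ‖η‖ ^ 2))) * k s ξ η) := by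
              refine lintegral_lintegral_swap ?_
              have := hk' s
              simp only [Function.uncurry_def]
              fun_prop
          _ = _ := by
              refine setLIntegral_congr_fun measurableSet_Ioi fun t ht => ?_
              have := hk' s
              rw [lintegral_const_mul _ (by fun_prop), hG s t hs ht]
    _ = ∫⁻ t in Set.Ioi (0 : ℝ), ∫⁻ s in Set.Ioi (0 : ℝ), ENNReal.ofReal (√s)⁻¹ *
          (W t * (m ξ * ENNReal.ofReal ((√(1 + t * s))⁻¹ ^ n *
          Real.exp (-(Real.pi * t * ‖ξ‖ ^ 2 / (1 + t * s)))))) := by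
        refine lintegral_lintegral_swap ?_
        simp only [Function.uncurry_def]
        fun_prop
    _ = ∫⁻ t in Set.Ioi (0 : ℝ), ∫⁻ z in Set.Ioi (0 : ℝ),
          m ξ * ENNReal.ofReal ((√z)⁻¹ * (√(1 + z))⁻¹ ^ n) *
          (W t * ENNReal.ofReal ((√t)⁻¹ * Real.exp (-(Real.pi * t * ‖ξ‖ ^ 2 / (1 + z))))) := by
        refine setLIntegral_congr_fun measurableSet_Ioi fun t ht => ?_
        have ht : 0 < t := ht
        rw [lintegral_Ioi_comp_div ht]
        refine setLIntegral_congr_fun measurableSet_Ioi fun z hz => ?_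
        have hz : 0 < z := hz
        have e : t * (z / t) = z := by field_simp
        have e2 : t⁻¹ * (√(z / t))⁻¹ = (√z)⁻¹ * (√t)⁻¹ := by
          rw [Real.sqrt_div hz.le]
          have h1 : 0 < √z := by positivity
          have h2 : 0 < √t := by positivity
          have h3 : t = √t * √t := (Real.mul_self_sqrt ht.le).symm
          rw [h3]
          simp only [Real.sqrt_mul_self h2.le]
          field_simp
        rw [e, ← mul_assoc, ← ENNReal.ofReal_mul (by positivity), e2,
          ENNReal.ofReal_mul (by positivity), ENNReal.ofReal_mul (by positivity),
          ENNReal.ofReal_mul (by positivity), ENNReal.ofReal_mul (by positivity)]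
        ring
    _ = ∫⁻ z in Set.Ioi (0 : ℝ), ∫⁻ t in Set.Ioi (0 : ℝ),
          m ξ * ENNReal.ofReal ((√z)⁻¹ * (√(1 + z))⁻¹ ^ n) *
          (W t * ENNReal.ofReal ((√t)⁻¹ * Real.exp (-(Real.pi * t * ‖ξ‖ ^ 2 / (1 + z))))) := by
        refine lintegral_lintegral_swap ?_
        simp only [Function.uncurry_def]
        fun_prop
    _ = _ := by
        refine lintegral_congr fun z => ?_
        rw [lintegral_const_mul _ (by fun_prop)]

/-- The weight used in the Schur test for the full kernel. -/
def evenSchurWt (η : V3) : ENNReal := ∫⁻ t in Set.Ioi (0 : ℝ),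
  ENNReal.ofReal (Real.exp (-(1 / (4 * Real.pi) * t))) *
    ENNReal.ofReal (Real.exp (-(Real.pi * t * ‖η‖ ^ 2)))

/-- The weight used in the Schur test on odd functions. -/
def oddSchurWt (i : Fin 3) (η : V3) : ENNReal := ENNReal.ofReal |η i| *
  ∫⁻ t in Set.Ioi (0 : ℝ), ENNReal.ofReal (√t) *
    ENNReal.ofReal (Real.exp (-(Real.pi * t * ‖η‖ ^ 2)))

theorem evenSchurWt_eq (η : V3) : evenSchurWt η =
    ENNReal.ofReal (4 * Real.pi / (1 + (2 * Real.pi * ‖η‖) ^ 2)) := by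
  have := Real.pi_pos
  have h := lintegral_exp_neg_mul_Ioi
    (show 0 < 1 / (4 * Real.pi) + Real.pi * ‖η‖ ^ 2 by positivity)
  rw [evenSchurWt]
  simp only [← ENNReal.ofReal_mul (Real.exp_nonneg _), ← Real.exp_add]
  have e : 1 / (1 / (4 * Real.pi) + Real.pi * ‖η‖ ^ 2) =
      4 * Real.pi / (1 + (2 * Real.pi * ‖η‖) ^ 2) := by
    field_simp; ring
  rw [← e, ← h]
  refine lintegral_congr fun t => ?_
  ring_nf

theorem oddSchurWt_eq (i : Fin 3) {η : V3} (hη : η ≠ 0) : oddSchurWt i η =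
    ENNReal.ofReal (|η i| / (2 * Real.pi * ‖η‖ ^ 3)) := by
  have := Real.pi_pos
  have hn : 0 < ‖η‖ := norm_pos_iff.2 hη
  have h := lintegral_sqrt_mul_exp_neg_mul_Ioi (show 0 < Real.pi * ‖η‖ ^ 2 by positivity)
  have e : |η i| * (√(Real.pi / (Real.pi * ‖η‖ ^ 2)) / (2 * (Real.pi * ‖η‖ ^ 2))) =
      |η i| / (2 * Real.pi * ‖η‖ ^ 3) := by
    rw [show Real.pi / (Real.pi * ‖η‖ ^ 2) = (1 / ‖η‖) ^ 2 by field_simp,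
      Real.sqrt_sq (by positivity)]
    field_simp
  rw [oddSchurWt, ← e, ENNReal.ofReal_mul (abs_nonneg _), ← h]
  congr 1
  refine lintegral_congr fun t => ?_
  rw [← ENNReal.ofReal_mul (Real.sqrt_nonneg _)]
  ring_nf

theorem measurable_evenSchurWt : Measurable evenSchurWt := by
  simp only [funext evenSchurWt_eq]; fun_prop

theorem measurable_oddSchurWt (i : Fin 3) : Measurable (oddSchurWt i) := by
  refine Measurable.mul (by fun_prop) (Measurable.lintegral_prod_right'
    (f := fun p : V3 × ℝ => ENNReal.ofReal (√p.2) *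
      ENNReal.ofReal (Real.exp (-(Real.pi * p.2 * ‖p.1‖ ^ 2)))) ?_)
  fun_prop

theorem evenSchurWt_bound {ξ : V3} (hξ : ξ ≠ 0) :
    ∫⁻ s in Set.Ioi (0 : ℝ), ENNReal.ofReal (√s)⁻¹ *
        ∫⁻ η, evenSchurWt η * ENNReal.ofReal (heatKer s (ξ - η)) =
      ENNReal.ofReal (evenWt (2 * Real.pi * ‖ξ‖)) * evenSchurWt ξ := by
  have hpi := Real.pi_pos
  have hn : 0 < ‖ξ‖ := norm_pos_iff.2 hξ
  have h := lintegral_inv_sqrt_mul_kernel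
    (W := fun t => ENNReal.ofReal (Real.exp (-(1 / (4 * Real.pi) * t)))) (m := fun _ => 1)
    (k := fun s ξ η => ENNReal.ofReal (heatKer s (ξ - η))) (by fun_prop) (by fun_prop)
    (by unfold heatKer; fun_prop) 3 ξ (fun s t hs ht => by
      rw [one_mul, ← lintegral_exp_mul_heatKer hs ht]
      refine lintegral_congr fun η => ?_
      rw [one_mul, ENNReal.ofReal_mul (Real.exp_nonneg _)])
  simp only [one_mul] at h
  rw [show (∫⁻ s in Set.Ioi (0 : ℝ), ENNReal.ofReal (√s)⁻¹ *
        ∫⁻ η, evenSchurWt η * ENNReal.ofReal (heatKer s (ξ - η))) = _ from h, evenSchurWt_eq,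
    ← ENNReal.ofReal_mul (by
      rw [evenWt]
      have := Real.arctan_pos.2 (show 0 < 2 * Real.pi * ‖ξ‖ by positivity)
      positivity)]
  set p := 2 * Real.pi * ‖ξ‖ with hp
  have hp0 : 0 < p := by positivity
  have e : evenWt p * (4 * Real.pi / (1 + p ^ 2)) = 2 * Real.pi * (2 / p * Real.arctan p) := by
    rw [evenWt]; field_simp; ring
  rw [e, ENNReal.ofReal_mul (by positivity),
    ← lintegral_inv_sqrt_mul_inv_one_add_mul_inv_sqrt hp0, ← lintegral_const_mul _ (by fun_prop)]
  refine setLIntegral_congr_fun measurableSet_Ioi fun z hz => ?_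
  have hz : 0 < z := hz
  have h2 := lintegral_inv_sqrt_mul_exp_neg_mul_Ioi
    (show 0 < 1 / (4 * Real.pi) + Real.pi * ‖ξ‖ ^ 2 / (1 + z) by positivity)
  have e2 : Real.pi / (1 / (4 * Real.pi) + Real.pi * ‖ξ‖ ^ 2 / (1 + z)) =
      (2 * Real.pi) ^ 2 * ((1 + z) / (z + (1 + p ^ 2))) := by
    rw [hp]; field_simp; ring
  rw [e2, Real.sqrt_mul (by positivity), Real.sqrt_sq (by positivity),
    Real.sqrt_div (by positivity)] at h2
  have e3 : ∫⁻ t in Set.Ioi (0 : ℝ), ENNReal.ofReal (Real.exp (-(1 / (4 * Real.pi) * t))) *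
      ENNReal.ofReal ((√t)⁻¹ * Real.exp (-(Real.pi * t * ‖ξ‖ ^ 2 / (1 + z)))) =
      ENNReal.ofReal (2 * Real.pi * (√(1 + z) / √(z + (1 + p ^ 2)))) := by
    rw [← h2]
    refine lintegral_congr fun t => ?_
    rw [← ENNReal.ofReal_mul (Real.exp_nonneg _), mul_left_comm, ← Real.exp_add]
    ring_nf
  rw [e3, ← ENNReal.ofReal_mul (by positivity), ← ENNReal.ofReal_mul (by positivity)]
  congr 1
  have h3 : 0 < √(1 + z) := by positivity
  have h4 : √(1 + z) ^ 2 = 1 + z := Real.sq_sqrt (by positivity)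
  have h5 : 0 < √z := by positivity
  have h6 : 0 < √(z + (1 + p ^ 2)) := by positivity
  field_simp
  rw [h4, add_comm]

theorem oddSchurWt_bound (i : Fin 3) {ξ : V3} (hξ : ξ ≠ 0) :
    ∫⁻ s in Set.Ioi (0 : ℝ), ENNReal.ofReal (√s)⁻¹ *
        ∫⁻ η, oddSchurWt i η * ENNReal.ofReal (oddKer i s ξ η) =
      ENNReal.ofReal (oddWt (2 * Real.pi * ‖ξ‖)) * oddSchurWt i ξ := by
  have hpi := Real.pi_pos
  have hn : 0 < ‖ξ‖ := norm_pos_iff.2 hξ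
  have h := lintegral_inv_sqrt_mul_kernel
    (W := fun t => ENNReal.ofReal (√t)) (m := fun η => ENNReal.ofReal |η i|)
    (k := fun s ξ η => ENNReal.ofReal (oddKer i s ξ η)) (by fun_prop) (by fun_prop)
    (by unfold oddKer heatKer; fun_prop) 5 ξ (fun s t hs ht => by
      rw [← ENNReal.ofReal_mul (by positivity), ← lintegral_coord_mul_exp_mul_oddKer hs ht]
      refine lintegral_congr fun η => ?_
      rw [ENNReal.ofReal_mul (by positivity), ENNReal.ofReal_mul (by positivity)])
  rw [show (∫⁻ s in Set.Ioi (0 : ℝ), ENNReal.ofReal (√s)⁻¹ *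
        ∫⁻ η, oddSchurWt i η * ENNReal.ofReal (oddKer i s ξ η)) = _ from h, oddSchurWt_eq i hξ,
    ← ENNReal.ofReal_mul (oddWt_nonneg (by positivity))]
  have e : oddWt (2 * Real.pi * ‖ξ‖) * (|ξ i| / (2 * Real.pi * ‖ξ‖ ^ 3)) =
      (|ξ i| / (Real.pi * ‖ξ‖ ^ 2)) * 2 := by
    rw [oddWt]; field_simp
  have e2 : ENNReal.ofReal 2 = _ := (ENNReal.ofReal_ofNat 2).trans
    lintegral_inv_sqrt_mul_inv_one_add_mul_sqrt.symm
  rw [e, ENNReal.ofReal_mul (by positivity), e2, ← lintegral_const_mul _ (by fun_prop)]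
  refine setLIntegral_congr_fun measurableSet_Ioi fun z hz => ?_
  have hz : 0 < z := hz
  have h2 := lintegral_exp_neg_mul_Ioi
    (show 0 < Real.pi * ‖ξ‖ ^ 2 / (1 + z) by positivity)
  have e3 : ∫⁻ t in Set.Ioi (0 : ℝ), ENNReal.ofReal (√t) *
      ENNReal.ofReal ((√t)⁻¹ * Real.exp (-(Real.pi * t * ‖ξ‖ ^ 2 / (1 + z)))) =
      ENNReal.ofReal (1 / (Real.pi * ‖ξ‖ ^ 2 / (1 + z))) := by
    rw [← h2]
    refine setLIntegral_congr_fun measurableSet_Ioi fun t ht => ?_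
    have : 0 < √t := Real.sqrt_pos.2 ht
    rw [← ENNReal.ofReal_mul (Real.sqrt_nonneg _), mul_inv_cancel_left₀ this.ne']
    ring_nf
  rw [e3, ← ENNReal.ofReal_mul (by positivity), ← ENNReal.ofReal_mul (by positivity),
    ← ENNReal.ofReal_mul (by positivity)]
  congr 1
  rw [add_comm z 1]
  have h3 : 0 < √(1 + z) := by positivity
  have h4 : 1 + z = √(1 + z) ^ 2 := (Real.sq_sqrt (by positivity)).symm
  have h5 : 0 < √z := by positivity
  field_simp
  rw [show √(1 + z) ^ 4 = (√(1 + z) ^ 2) ^ 2 by ring, ← h4]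

open scoped FourierTransform in
theorem fourierInv_modulated_gaussian {s : ℝ} (hs : 0 < s) (ξ η : V3) :
    𝓕⁻ (fun x : V3 => cexp (-((Real.pi * s : ℝ) : ℂ) * ‖x‖ ^ 2 +
      2 * Real.pi * I * (inner ℝ (-ξ) x : ℝ))) η = (heatKer s (ξ - η) : ℂ) := by
  rw [Real.fourierInv_eq_fourier_neg, fourier_gaussian_innerProductSpace'
    (by rw [ofReal_re]; positivity)]
  have h1 : ((Real.pi : ℂ) / ((Real.pi * s : ℝ) : ℂ)) = ((s⁻¹ : ℝ) : ℂ) := by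
    have : (Real.pi : ℂ) ≠ 0 := by exact_mod_cast Real.pi_ne_zero
    push_cast
    field_simp
  have h2 : ((Module.finrank ℝ V3 : ℂ) / 2) = ((3 / 2 : ℝ) : ℂ) := by
    simp
  have h5 : (s⁻¹ : ℝ) ^ (3 / 2 : ℝ) = (√s)⁻¹ ^ 3 := by
    rw [Real.sqrt_eq_rpow, ← Real.rpow_neg_one, ← Real.rpow_neg_one, ← Real.rpow_mul hs.le,
      ← Real.rpow_natCast, ← Real.rpow_mul hs.le, ← Real.rpow_mul hs.le]
    norm_num
  rw [h1, h2, ← ofReal_cpow (by positivity), h5, heatKer, ofReal_mul ((√s)⁻¹ ^ 3)]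
  congr 1
  · rw [ofReal_exp, show -ξ - -η = -(ξ - η) by abel, norm_neg]
    congr 1
    have h3 : (Real.pi : ℂ) ≠ 0 := by exact_mod_cast Real.pi_ne_zero
    have h4 : (s : ℂ) ≠ 0 := by exact_mod_cast hs.ne'
    push_cast
    field_simp

open scoped FourierTransform in
/-- Integrating `|𝓕⁻ f|²` against a Gaussian amounts to a heat kernel quadratic form of `f`. -/
theorem integral_norm_sq_fourierInv_mul_gaussian {f : V3 → C4} (hf : Integrable f) {s : ℝ}
    (hs : 0 < s) :
    ((∫ x, ‖𝓕⁻ f x‖ ^ 2 * Real.exp (-(Real.pi * ‖x‖ ^ 2 * s)) : ℝ) : ℂ) =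
      ∫ ξ, ∫ η, (heatKer s (ξ - η) : ℂ) * inner ℂ (f ξ) (f η) := by
  have hcont : Continuous (𝓕⁻ f) :=
    VectorFourier.fourierIntegral_continuous Real.continuous_fourierChar
      (L := -innerₗ V3) (by simpa using! continuous_inner.neg) hf
  have hbd : ∀ x, ‖𝓕⁻ f x‖ ≤ ∫ y, ‖f y‖ := fun x =>
    VectorFourier.norm_fourierIntegral_le_integral_norm _ _ _ _ _
  have hLc : Continuous fun p : V3 × V3 => (-innerₗ V3) p.1 p.2 := by
    simpa using! continuous_inner.neg
  have hgauss : Integrable fun x : V3 => Real.exp (-(Real.pi * ‖x‖ ^ 2 * s)) := by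
    refine (integrable_exp_neg_mul_sq_norm (show 0 < Real.pi * s by positivity)).congr
      (ae_of_all _ fun x => ?_)
    simp only [neg_mul, mul_right_comm]
  set g : V3 → C4 := fun x => ((Real.exp (-(Real.pi * ‖x‖ ^ 2 * s)) : ℝ) : ℂ) • 𝓕⁻ f x with hg
  have hgauss' : Integrable fun x : V3 => ((Real.exp (-(Real.pi * ‖x‖ ^ 2 * s)) : ℝ) : ℂ) :=
    hgauss.ofReal
  have hgi : Integrable g :=
    Integrable.smul_bdd (C := ∫ y, ‖f y‖) hgauss' hcont.aestronglyMeasurable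
      (ae_of_all _ hbd)
  have h1 := VectorFourier.integral_sesq_fourierIntegral_eq_neg_flip (μ := volume) (ν := volume)
    (L := -innerₗ V3) (innerSL ℂ) Real.continuous_fourierChar hLc hf hgi
  have e1 : ∫ x, (innerSL ℂ) (𝓕⁻ f x) (g x) =
      ((∫ x, ‖𝓕⁻ f x‖ ^ 2 * Real.exp (-(Real.pi * ‖x‖ ^ 2 * s)) : ℝ) : ℂ) := by
    refine Eq.trans ?_ integral_ofReal
    refine integral_congr_ae (ae_of_all _ fun x => ?_)
    simp only [hg, innerSL_apply_apply, inner_smul_right, inner_self_eq_norm_sq_to_K]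
    change _ = ((‖𝓕⁻ f x‖ ^ 2 * Real.exp (-(Real.pi * ‖x‖ ^ 2 * s)) : ℝ) : ℂ)
    push_cast [coe_algebraMap]
    ring
  have e2 : ∀ ξ, VectorFourier.fourierIntegral Real.fourierChar volume (-(-innerₗ V3).flip) g ξ =
      ∫ η, (heatKer s (ξ - η) : ℂ) • f η := by
    intro ξ
    set φ : V3 → ℂ := fun x => cexp (-((Real.pi * s : ℝ) : ℂ) * ‖x‖ ^ 2 +
      2 * Real.pi * I * (inner ℝ (-ξ) x : ℝ)) with hφ
    have hφi : Integrable φ := by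
      simpa [hφ] using GaussianFourier.integrable_cexp_neg_mul_sq_norm_add
        (b := ((Real.pi * s : ℝ) : ℂ)) (by rw [ofReal_re]; positivity) (2 * Real.pi * I) (-ξ)
    have h3 := VectorFourier.integral_fourierIntegral_smul_eq_flip (μ := volume) (ν := volume)
      (L := -innerₗ V3) Real.continuous_fourierChar hLc hφi hf
    have e3 : ∀ η, VectorFourier.fourierIntegral Real.fourierChar volume (-innerₗ V3) φ η =
      (heatKer s (ξ - η) : ℂ) := fun η => fourierInv_modulated_gaussian hs ξ η
    have hflip : (-innerₗ V3).flip = -innerₗ V3 := by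
      ext x y; simp [real_inner_comm]
    simp only [e3, hflip] at h3
    rw [h3, hflip]
    refine integral_congr_ae (ae_of_all _ fun x => ?_)
    change Real.fourierChar _ • g x = φ x • 𝓕⁻ f x
    simp only [hg, hφ, Circle.smul_def, smul_smul, Real.fourierChar_apply, ofReal_exp,
      ← Complex.exp_add]
    congr 2
    simp [real_inner_comm]
    ring
  rw [← e1, show (∫ x, (innerSL ℂ) (𝓕⁻ f x) (g x)) = _ from h1]
  refine integral_congr_ae (ae_of_all _ fun ξ => ?_)
  simp only [e2, innerSL_apply_apply]
  rw [← integral_inner]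
  · simp only [inner_smul_right]
  · refine Integrable.bdd_smul (φ := fun η => (heatKer s (ξ - η) : ℂ)) (C := heatKer s 0) hf ?_
      (ae_of_all _ fun η => ?_)
    · exact (continuous_ofReal.comp ((continuous_heatKer s).comp
        (continuous_const.sub continuous_id))).aestronglyMeasurable
    · rw [norm_real, Real.norm_of_nonneg (heatKer_nonneg _ _), heatKer, heatKer]
      gcongr
      simp

open scoped FourierTransform in
/-- The Coulomb energy of the inverse Fourier transform of `f`. -/
def coulombEnergy (f : V3 → C4) : ENNReal :=
  ∫⁻ x, ‖𝓕⁻ f x‖ₑ ^ 2 * ENNReal.ofReal (1 / ‖x‖)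

theorem ae_coord_ne_zero (i : Fin 3) : ∀ᵐ ξ : V3, ξ i ≠ 0 := by
  have h := Measure.addHaar_submodule (volume : Measure V3)
    (LinearMap.ker (EuclideanSpace.proj i : V3 →L[ℝ] ℝ).toLinearMap)
    (fun h => by
      have h1 : EuclideanSpace.single i (1 : ℝ) ∈ LinearMap.ker
        (EuclideanSpace.proj i : V3 →L[ℝ] ℝ).toLinearMap := by
          rw [h]; trivial
      simp at h1)
  rw [ae_iff]
  convert h using 2
  ext ξ
  simp

open scoped FourierTransform in
theorem lintegral_norm_sq_fourierInv_mul_gaussian {f : V3 → C4} (hf : Integrable f) {s : ℝ}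
    (hs : 0 < s) :
    ∫⁻ x, ‖𝓕⁻ f x‖ₑ ^ 2 * ENNReal.ofReal (Real.exp (-(Real.pi * ‖x‖ ^ 2 * s))) =
      ‖∫ ξ, ∫ η, (heatKer s (ξ - η) : ℂ) * inner ℂ (f ξ) (f η)‖ₑ := by
  have hcont : Continuous (𝓕⁻ f) :=
    VectorFourier.fourierIntegral_continuous Real.continuous_fourierChar
      (L := -innerₗ V3) (by simpa using! continuous_inner.neg) hf
  have hbd : ∀ x, ‖𝓕⁻ f x‖ ≤ ∫ y, ‖f y‖ := fun x =>
    VectorFourier.norm_fourierIntegral_le_integral_norm _ _ _ _ _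
  have hgauss : Integrable fun x : V3 => Real.exp (-(Real.pi * ‖x‖ ^ 2 * s)) := by
    refine (integrable_exp_neg_mul_sq_norm (show 0 < Real.pi * s by positivity)).congr
      (ae_of_all _ fun x => ?_)
    simp only [neg_mul, mul_right_comm]
  have hi : Integrable fun x =>
      ‖𝓕⁻ f x‖ ^ 2 * Real.exp (-(Real.pi * ‖x‖ ^ 2 * s)) := by
    refine Integrable.bdd_mul (c := (∫ y, ‖f y‖) ^ 2) hgauss
      (hcont.norm.pow 2).aestronglyMeasurable (ae_of_all _ fun x => ?_)
    rw [Real.norm_of_nonneg (by positivity)]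
    gcongr
    exact hbd x
  rw [← integral_norm_sq_fourierInv_mul_gaussian hf hs, ← ofReal_norm, norm_real,
    Real.norm_of_nonneg (by positivity),
    ofReal_integral_eq_lintegral_ofReal hi (ae_of_all _ fun x => by positivity)]
  refine lintegral_congr fun x => ?_
  rw [ENNReal.ofReal_mul (by positivity), ENNReal.ofReal_pow (norm_nonneg _),
    ofReal_norm]

theorem integrable_heatKer_mul_inner {f : V3 → C4} (hf : Integrable f) {s : ℝ}
    (hs : 0 < s) (ξ : V3) {T : V3 → V3} (hT : Continuous T) :
    Integrable fun η => (heatKer s (ξ - T η) : ℂ) * inner ℂ (f ξ) (f η) := by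
  refine Integrable.bdd_mul (c := heatKer s 0) (hf.const_inner (f ξ))
    (continuous_ofReal.comp ((continuous_heatKer s).comp
      (continuous_const.sub hT))).aestronglyMeasurable (ae_of_all _ fun η => ?_)
  rw [norm_real, Real.norm_of_nonneg (heatKer_nonneg _ _), heatKer, heatKer]
  gcongr
  simp

theorem enorm_integral_integral_le {k : V3 → V3 → ℂ} {f : V3 → C4} :
    ‖∫ ξ, ∫ η, k ξ η * inner ℂ (f ξ) (f η)‖ₑ ≤ ∫⁻ ξ, ∫⁻ η, ‖f ξ‖ₑ * ‖f η‖ₑ * ‖k ξ η‖ₑ := by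
  refine (enorm_integral_le_lintegral_enorm _).trans (lintegral_mono fun ξ => ?_)
  refine (enorm_integral_le_lintegral_enorm _).trans (lintegral_mono fun η => ?_)
  rw [enorm_mul, mul_comm]
  refine mul_le_mul' ?_ le_rfl
  rw [← ofReal_norm, ← ofReal_norm, ← ofReal_norm,
    ← ENNReal.ofReal_mul (norm_nonneg _)]
  exact ENNReal.ofReal_le_ofReal (norm_inner_le_norm _ _)

theorem enorm_ofReal_eq (r : ℝ) : ‖(r : ℂ)‖ₑ = ENNReal.ofReal |r| := by
  rw [← ofReal_norm, norm_real, Real.norm_eq_abs]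

open scoped FourierTransform in
theorem measurable_enorm_fourierInv {f : V3 → C4} (hf : Integrable f) :
    Measurable fun x => ‖𝓕⁻ f x‖ₑ ^ 2 :=
  ((VectorFourier.fourierIntegral_continuous Real.continuous_fourierChar
      (L := -innerₗ V3) (by simpa using! continuous_inner.neg) hf).enorm.measurable).pow_const 2

theorem coulombEnergy_le_evenWt {f : V3 → C4} (hf : Integrable f) (hm : Measurable f) :
    coulombEnergy f ≤ ∫⁻ ξ, ENNReal.ofReal (evenWt (2 * Real.pi * ‖ξ‖)) * ‖f ξ‖ₑ ^ 2 := by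
  refine lintegral_coulomb_le_of_schur (h := evenSchurWt) (a := fun ξ => ‖f ξ‖ₑ)
    (k := fun s ξ η => ENNReal.ofReal (heatKer s (ξ - η)))
    (measurable_enorm_fourierInv hf) hm.enorm measurable_evenSchurWt
    (by unfold heatKer; fun_prop) (fun s x y => by rw [heatKer_sub_comm]) ?_ ?_ ?_ ?_
  · refine ae_of_all _ fun ξ => ?_
    rw [evenSchurWt_eq, ← pos_iff_ne_zero, ENNReal.ofReal_pos]
    have := Real.pi_pos
    positivity
  · refine ae_of_all _ fun ξ => ?_
    rw [evenSchurWt_eq]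
    exact ENNReal.ofReal_ne_top
  · intro s hs
    rw [lintegral_norm_sq_fourierInv_mul_gaussian hf hs]
    refine enorm_integral_integral_le.trans_eq ?_
    refine lintegral_congr fun ξ => lintegral_congr fun η => ?_
    rw [enorm_ofReal_eq, abs_of_nonneg (heatKer_nonneg _ _)]
  · filter_upwards [Measure.ae_ne volume (0 : V3)] with ξ hξ
    exact (evenSchurWt_bound hξ).le

theorem coulombEnergy_le_oddWt {f : V3 → C4} (hf : Integrable f) (hm : Measurable f) (i : Fin 3)
    (hodd : ∀ ξ, f (coordRefl i ξ) = -f ξ) :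
    coulombEnergy f ≤ ∫⁻ ξ, ENNReal.ofReal (oddWt (2 * Real.pi * ‖ξ‖)) * ‖f ξ‖ₑ ^ 2 := by
  refine lintegral_coulomb_le_of_schur (h := oddSchurWt i) (a := fun ξ => ‖f ξ‖ₑ)
    (k := fun s ξ η => ENNReal.ofReal (oddKer i s ξ η))
    (measurable_enorm_fourierInv hf) hm.enorm (measurable_oddSchurWt i)
    (by unfold oddKer heatKer; fun_prop) (fun s x y => by rw [oddKer_comm]) ?_ ?_ ?_ ?_
  · filter_upwards [ae_coord_ne_zero i] with ξ hξ
    have h0 : ξ ≠ 0 := by rintro rfl; exact hξ rfl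
    rw [oddSchurWt_eq i h0, ← pos_iff_ne_zero, ENNReal.ofReal_pos]
    have := Real.pi_pos
    have := norm_pos_iff.2 h0
    have := abs_pos.2 hξ
    positivity
  · filter_upwards [Measure.ae_ne volume (0 : V3)] with ξ hξ
    rw [oddSchurWt_eq i hξ]
    exact ENNReal.ofReal_ne_top
  · intro s hs
    rw [lintegral_norm_sq_fourierInv_mul_gaussian hf hs]
    have h1 : ∀ ξ, ∫ η, (heatKer s (ξ - η) : ℂ) * inner ℂ (f ξ) (f η) =
        ∫ η, (((heatKer s (ξ - η) - heatKer s (ξ - coordRefl i η)) / 2 : ℝ) : ℂ) *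
          inner ℂ (f ξ) (f η) := by
      intro ξ
      have hi1 : Integrable fun η => (heatKer s (ξ - η) : ℂ) * inner ℂ (f ξ) (f η) :=
        integrable_heatKer_mul_inner hf hs ξ continuous_id
      have hi2 := integrable_heatKer_mul_inner hf hs ξ (coordRefl i).continuous
      have h2 : ∫ η, (heatKer s (ξ - η) : ℂ) * inner ℂ (f ξ) (f η) =
          -∫ η, (heatKer s (ξ - coordRefl i η) : ℂ) * inner ℂ (f ξ) (f η) := by
        rw [← (measurePreserving_coordRefl i).integral_comp
          (coordRefl i).toHomeomorph.measurableEmbedding, ← integral_neg]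
        refine integral_congr_ae (ae_of_all _ fun η => ?_)
        simp only [hodd, inner_neg_right, mul_neg]
      have h3 : ∫ η, (((heatKer s (ξ - η) - heatKer s (ξ - coordRefl i η)) / 2 : ℝ) : ℂ) *
          inner ℂ (f ξ) (f η) = (∫ η, ((heatKer s (ξ - η) : ℂ) * inner ℂ (f ξ) (f η) -
            (heatKer s (ξ - coordRefl i η) : ℂ) * inner ℂ (f ξ) (f η))) / 2 := by
        rw [← integral_div]
        refine integral_congr_ae (ae_of_all _ fun η => ?_)
        push_cast
        ring
      rw [h3, integral_sub hi1 hi2]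
      linear_combination h2 / 2
    simp only [h1]
    refine enorm_integral_integral_le.trans_eq ?_
    refine lintegral_congr fun ξ => lintegral_congr fun η => ?_
    rw [enorm_ofReal_eq, abs_div, abs_two, oddKer]
  · filter_upwards [Measure.ae_ne volume (0 : V3)] with ξ hξ
    exact (oddSchurWt_bound i hξ).le

/-- The part of `f` which is symmetric under the involution `A`. -/
def symmPart (A : V3 ≃ₗᵢ[ℝ] V3) (f : V3 → C4) (ξ : V3) : C4 := (1 / 2 : ℂ) • (f ξ + f (A ξ))

/-- The part of `f` which is antisymmetric under the involution `A`. -/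
def antiPart (A : V3 ≃ₗᵢ[ℝ] V3) (f : V3 → C4) (ξ : V3) : C4 := (1 / 2 : ℂ) • (f ξ - f (A ξ))

theorem symmPart_add_antiPart (A : V3 ≃ₗᵢ[ℝ] V3) (f : V3 → C4) (ξ : V3) :
    symmPart A f ξ + antiPart A f ξ = f ξ := by
  simp only [symmPart, antiPart]
  module

theorem enorm_sq_symmPart_add_enorm_sq_antiPart (A : V3 ≃ₗᵢ[ℝ] V3) (f : V3 → C4) (ξ : V3) :
    ‖symmPart A f ξ‖ₑ ^ 2 + ‖antiPart A f ξ‖ₑ ^ 2 =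
      ENNReal.ofReal (1 / 2) * (‖f ξ‖ₑ ^ 2 + ‖f (A ξ)‖ₑ ^ 2) := by
  have h := parallelogram_law_with_norm ℂ (f ξ) (f (A ξ))
  simp only [← ofReal_norm, ← ENNReal.ofReal_pow (norm_nonneg _)]
  rw [← ENNReal.ofReal_add (by positivity) (by positivity),
    ← ENNReal.ofReal_add (by positivity) (by positivity), ← ENNReal.ofReal_mul (by positivity)]
  congr 1
  rw [symmPart, antiPart, norm_smul, norm_smul]
  have : ‖(1 / 2 : ℂ)‖ = 1 / 2 := by simp
  rw [this]
  linarith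

section

variable {A : V3 ≃ₗᵢ[ℝ] V3} {f : V3 → C4}

theorem measurable_symmPart (hf : Measurable f) : Measurable (symmPart A f) := by
  have := A.continuous.measurable
  unfold symmPart
  fun_prop

theorem measurable_antiPart (hf : Measurable f) : Measurable (antiPart A f) := by
  have := A.continuous.measurable
  unfold antiPart
  fun_prop

theorem integrable_comp_isometry (hf : Integrable f) : Integrable fun ξ => f (A ξ) :=
  A.measurePreserving.integrable_comp_of_integrable hf

theorem integrable_symmPart (hf : Integrable f) : Integrable (symmPart A f) :=
  (hf.add (integrable_comp_isometry hf)).smul (1 / 2 : ℂ)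

theorem integrable_antiPart (hf : Integrable f) : Integrable (antiPart A f) :=
  (hf.sub (integrable_comp_isometry hf)).smul (1 / 2 : ℂ)

theorem antiPart_comp (hA : ∀ ξ, A (A ξ) = ξ) (ξ : V3) : antiPart A f (A ξ) = -antiPart A f ξ := by
  simp only [antiPart, hA]
  module

theorem lintegral_enorm_sq_split {w : V3 → ENNReal} (hf : Measurable f) (hw : Measurable w)
    (hA : ∀ ξ, w (A ξ) = w ξ) :
    ∫⁻ ξ, ‖f ξ‖ₑ ^ 2 * w ξ =
      (∫⁻ ξ, ‖symmPart A f ξ‖ₑ ^ 2 * w ξ) + ∫⁻ ξ, ‖antiPart A f ξ‖ₑ ^ 2 * w ξ := by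
  have h1 : ∫⁻ ξ, ‖f (A ξ)‖ₑ ^ 2 * w ξ = ∫⁻ ξ, ‖f ξ‖ₑ ^ 2 * w ξ := by
    have h := A.measurePreserving.lintegral_comp
      (show Measurable fun ξ => ‖f ξ‖ₑ ^ 2 * w ξ from (hf.enorm.pow_const 2).mul hw)
    simpa only [hA] using h
  have hs : Measurable (symmPart A f) := measurable_symmPart hf
  have hfA : Measurable fun ξ => f (A ξ) := hf.comp A.continuous.measurable
  rw [← lintegral_add_left
    (show Measurable fun ξ => ‖symmPart A f ξ‖ₑ ^ 2 * w ξ from (hs.enorm.pow_const 2).mul hw)]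
  simp only [← add_mul, enorm_sq_symmPart_add_enorm_sq_antiPart, mul_assoc]
  rw [lintegral_const_mul _ (by fun_prop)]
  simp only [add_mul]
  rw [lintegral_add_left (by fun_prop), h1, ← two_mul, ← mul_assoc]
  have : ENNReal.ofReal (1 / 2) * 2 = 1 := by
    rw [← ENNReal.ofReal_ofNat 2, ← ENNReal.ofReal_mul (by norm_num)]
    norm_num
  rw [this, one_mul]

open scoped FourierTransform in
theorem fourierInv_symmPart (hf : Integrable f) : 𝓕⁻ (symmPart A f) = symmPart A (𝓕⁻ f) := by
  have hLc : Continuous fun p : V3 × V3 => (-innerₗ V3) p.1 p.2 := by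
    simpa using! continuous_inner.neg
  ext1 x
  rw [symmPart, ← Real.fourierInv_comp_linearIsometry]
  have h := congrFun (VectorFourier.fourierIntegral_const_smul Real.fourierChar volume
    (-innerₗ V3) (f + f ∘ A) (1 / 2 : ℂ)) x
  have hfA : Integrable (f ∘ A) := integrable_comp_isometry hf
  rw [VectorFourier.fourierIntegral_add Real.continuous_fourierChar hLc hf hfA] at h
  exact h

open scoped FourierTransform in
theorem fourierInv_antiPart (hf : Integrable f) : 𝓕⁻ (antiPart A f) = antiPart A (𝓕⁻ f) := by
  have h : antiPart A f = f - symmPart A f := by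
    ext1 ξ
    rw [Pi.sub_apply, eq_sub_iff_add_eq, add_comm, symmPart_add_antiPart]
  have hLc : Continuous fun p : V3 × V3 => (-innerₗ V3) p.1 p.2 := by
    simpa using! continuous_inner.neg
  ext1 x
  have h2 := congrFun (VectorFourier.fourierIntegral_add (μ := volume) Real.continuous_fourierChar
    hLc (integrable_symmPart (A := A) hf) (integrable_antiPart (A := A) hf)) x
  have h3 : symmPart A f + antiPart A f = f := funext (symmPart_add_antiPart A f)
  rw [h3] at h2
  have h4 : 𝓕⁻ f x = 𝓕⁻ (symmPart A f) x + 𝓕⁻ (antiPart A f) x := h2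
  rw [fourierInv_symmPart hf, ← symmPart_add_antiPart A (𝓕⁻ f) x] at h4
  exact (add_left_cancel h4).symm

theorem coulombEnergy_eq_add (hf : Integrable f) :
    coulombEnergy f = coulombEnergy (symmPart A f) + coulombEnergy (antiPart A f) := by
  simp only [coulombEnergy, fourierInv_symmPart hf, fourierInv_antiPart hf]
  refine lintegral_enorm_sq_split ?_ (by fun_prop) fun ξ => by rw [A.norm_map]
  exact (VectorFourier.fourierIntegral_continuous Real.continuous_fourierChar
      (L := -innerₗ V3) (by simpa using! continuous_inner.neg) hf).measurable

end

theorem coulombEnergy_le_oddWt_of_odd {f : V3 → C4} (hf : Integrable f) (hm : Measurable f)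
    (hodd : ∀ ξ, f (-ξ) = -f ξ) :
    coulombEnergy f ≤ ∫⁻ ξ, ENNReal.ofReal (oddWt (2 * Real.pi * ‖ξ‖)) * ‖f ξ‖ₑ ^ 2 := by
  have hw : Measurable fun ξ : V3 => ENNReal.ofReal (oddWt (2 * Real.pi * ‖ξ‖)) := by
    unfold oddWt
    fun_prop
  have split : ∀ (i : Fin 3) (g : V3 → C4), Integrable g → Measurable g →
      coulombEnergy (symmPart (coordRefl i) g) ≤ ∫⁻ ξ, ‖symmPart (coordRefl i) g ξ‖ₑ ^ 2 *
        ENNReal.ofReal (oddWt (2 * Real.pi * ‖ξ‖)) →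
      coulombEnergy g ≤ ∫⁻ ξ, ‖g ξ‖ₑ ^ 2 * ENNReal.ofReal (oddWt (2 * Real.pi * ‖ξ‖)) := by
    intro i g hg hgm h
    rw [coulombEnergy_eq_add (A := coordRefl i) hg, lintegral_enorm_sq_split (A := coordRefl i)
      hgm hw fun ξ => by rw [LinearIsometryEquiv.norm_map]]
    refine add_le_add h ((coulombEnergy_le_oddWt (integrable_antiPart hg) (measurable_antiPart hgm)
      i (antiPart_comp (coordRefl_coordRefl i))).trans_eq ?_)
    simp only [mul_comm]
  have h0 : symmPart (coordRefl 2) (symmPart (coordRefl 1) (symmPart (coordRefl 0) f)) = 0 := by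
    ext1 ξ
    have h1 : ∀ ξ, f (coordRefl 0 (coordRefl 1 (coordRefl 2 ξ))) = -f ξ := fun ξ => by
      rw [coordRefl_coordRefl_coordRefl, hodd]
    have h2 : f (coordRefl 0 (coordRefl 1 ξ)) = -f (coordRefl 2 ξ) := by
      rw [← h1, coordRefl_coordRefl]
    have h3 : f (coordRefl 0 (coordRefl 2 ξ)) = -f (coordRefl 1 ξ) := by
      rw [← h1, coordRefl_comm 2 1, coordRefl_coordRefl]
    have h4 : f (coordRefl 1 (coordRefl 2 ξ)) = -f (coordRefl 0 ξ) := by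
      rw [← h1, coordRefl_comm 2 0, coordRefl_comm 1 0, coordRefl_coordRefl]
    simp only [symmPart, h1, h2, h3, h4, Pi.zero_apply]
    module
  simp only [mul_comm (ENNReal.ofReal _)]
  refine split 0 f hf hm (split 1 _ (integrable_symmPart hf) (measurable_symmPart hm)
    (split 2 _ (integrable_symmPart (integrable_symmPart hf))
      (measurable_symmPart (measurable_symmPart hm)) ?_))
  rw [h0]
  have : coulombEnergy 0 = 0 := by
    simp [coulombEnergy, Real.fourierInv_eq]
  rw [this]
  exact zero_le

theorem coulombEnergy_le {f : V3 → C4} (hf : Integrable f) (hm : Measurable f) :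
    coulombEnergy f ≤ ∫⁻ ξ,
      (ENNReal.ofReal (evenWt (2 * Real.pi * ‖ξ‖)) *
          ‖symmPart (LinearIsometryEquiv.neg ℝ) f ξ‖ₑ ^ 2 +
        ENNReal.ofReal (oddWt (2 * Real.pi * ‖ξ‖)) *
          ‖antiPart (LinearIsometryEquiv.neg ℝ) f ξ‖ₑ ^ 2) := by
  have hm1 : Measurable (antiPart (LinearIsometryEquiv.neg ℝ) f) := measurable_antiPart hm
  rw [coulombEnergy_eq_add (A := LinearIsometryEquiv.neg ℝ) hf, lintegral_add_right]
  · exact add_le_add (coulombEnergy_le_evenWt (integrable_symmPart hf) (measurable_symmPart hm))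
      (coulombEnergy_le_oddWt_of_odd (integrable_antiPart hf) hm1
        (antiPart_comp fun ξ => neg_neg ξ))
  · unfold oddWt
    fun_prop

/-- The relativistic energy at the frequency `ξ`, i.e. at momentum `2πξ`. -/
def energy (ξ : V3) : ℝ := √(1 + (2 * Real.pi * ‖ξ‖) ^ 2)

theorem one_le_energy (ξ : V3) : 1 ≤ energy ξ := by
  rw [energy, Real.one_le_sqrt]
  nlinarith [sq_nonneg (2 * Real.pi * ‖ξ‖)]

theorem energy_pos (ξ : V3) : 0 < energy ξ := zero_lt_one.trans_le (one_le_energy ξ)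

theorem energy_sq (ξ : V3) : energy ξ ^ 2 = 1 + (2 * Real.pi * ‖ξ‖) ^ 2 :=
  Real.sq_sqrt (by positivity)

theorem energy_neg (ξ : V3) : energy (-ξ) = energy ξ := by rw [energy, energy, norm_neg]

theorem continuous_energy : Continuous energy := by
  unfold energy
  fun_prop

/-- A `4 × 4` matrix as a bounded operator on spinors. -/
def mappCLM (M : Matrix (Fin 4) (Fin 4) ℂ) : C4 →L[ℂ] C4 := Matrix.toEuclideanCLM (𝕜 := ℂ) M

theorem mappCLM_apply (M : Matrix (Fin 4) (Fin 4) ℂ) (v : C4) : mappCLM M v = mapp M v := rfl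

/-- The symbol `β + 2π Σ_j ξ_j α_j` of the free Dirac operator. -/
def diracSym (ξ : V3) : C4 →L[ℂ] C4 :=
  mappCLM diracβ + ∑ j : Fin 3, ((2 * Real.pi * ξ j : ℝ) : ℂ) • mappCLM (diracα j)

theorem diracSym_apply (ξ : V3) (v : C4) :
    diracSym ξ v =
      mapp diracβ v + ∑ j : Fin 3, ((2 * Real.pi * ξ j : ℝ) : ℂ) • mapp (diracα j) v := by
  simp [diracSym, mappCLM_apply]

theorem continuous_diracSym : Continuous diracSym := by
  unfold diracSym
  fun_prop

theorem diracSym_coord (ξ : V3) (v : C4) :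
    diracSym ξ v 0 = v 0 + (((2 * Real.pi * ξ 2 : ℝ) : ℂ) * v 2 +
      (((2 * Real.pi * ξ 0 : ℝ) : ℂ) - I * ((2 * Real.pi * ξ 1 : ℝ) : ℂ)) * v 3) ∧
    diracSym ξ v 1 = v 1 + ((((2 * Real.pi * ξ 0 : ℝ) : ℂ) +
      I * ((2 * Real.pi * ξ 1 : ℝ) : ℂ)) * v 2 - ((2 * Real.pi * ξ 2 : ℝ) : ℂ) * v 3) ∧
    diracSym ξ v 2 = -v 2 + (((2 * Real.pi * ξ 2 : ℝ) : ℂ) * v 0 +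
      (((2 * Real.pi * ξ 0 : ℝ) : ℂ) - I * ((2 * Real.pi * ξ 1 : ℝ) : ℂ)) * v 1) ∧
    diracSym ξ v 3 = -v 3 + ((((2 * Real.pi * ξ 0 : ℝ) : ℂ) +
      I * ((2 * Real.pi * ξ 1 : ℝ) : ℂ)) * v 0 - ((2 * Real.pi * ξ 2 : ℝ) : ℂ) * v 1) := by
  refine ⟨?_, ?_, ?_, ?_⟩ <;>
  · rw [diracSym_apply]
    simp [mapp, Fin.sum_univ_three, diracα, diracβ, dotProduct, Fin.sum_univ_four]
    ring

theorem norm_sq_pauli_mul (k₀ k₁ k₂ : ℝ) (a b : ℂ) :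
    ‖(k₂ : ℂ) * a + ((k₀ : ℂ) - I * k₁) * b‖ ^ 2 + ‖((k₀ : ℂ) + I * k₁) * a - k₂ * b‖ ^ 2 =
      (k₀ ^ 2 + k₁ ^ 2 + k₂ ^ 2) * (‖a‖ ^ 2 + ‖b‖ ^ 2) := by
  simp only [← normSq_eq_norm_sq, normSq_apply]
  simp
  ring

theorem norm_sq_eq_coord (ξ : V3) :
    (2 * Real.pi * ‖ξ‖) ^ 2 = (2 * Real.pi * ξ 0) ^ 2 + (2 * Real.pi * ξ 1) ^ 2 +
      (2 * Real.pi * ξ 2) ^ 2 := by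
  rw [mul_pow, EuclideanSpace.norm_sq_eq, Fin.sum_univ_three]
  simp only [Real.norm_eq_abs, sq_abs]
  ring

theorem diracSym_diracSym (ξ : V3) (v : C4) :
    diracSym ξ (diracSym ξ v) = ((energy ξ ^ 2 : ℝ) : ℂ) • v := by
  rw [energy_sq, norm_sq_eq_coord]
  obtain ⟨h0, h1, h2, h3⟩ := diracSym_coord ξ v
  obtain ⟨k0, k1, k2, k3⟩ := diracSym_coord ξ (diracSym ξ v)
  rw [h0, h2, h3] at k0
  rw [h1, h2, h3] at k1
  rw [h0, h1, h2] at k2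
  rw [h0, h1, h3] at k3
  have hI : I ^ 2 = -1 := I_sq
  ext i
  fin_cases i
  · refine k0.trans ?_
    simp
    linear_combination -(2 * (Real.pi : ℂ) * (ξ 1 : ℂ)) ^ 2 * v 0 * hI
  · refine k1.trans ?_
    simp
    linear_combination -(2 * (Real.pi : ℂ) * (ξ 1 : ℂ)) ^ 2 * v 1 * hI
  · refine k2.trans ?_
    simp
    linear_combination -(2 * (Real.pi : ℂ) * (ξ 1 : ℂ)) ^ 2 * v 2 * hI
  · refine k3.trans ?_
    simp
    linear_combination -(2 * (Real.pi : ℂ) * (ξ 1 : ℂ)) ^ 2 * v 3 * hI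

theorem inner_diracSym (ξ : V3) (v w : C4) :
    inner ℂ (diracSym ξ v) w = inner ℂ v (diracSym ξ w) := by
  obtain ⟨h0, h1, h2, h3⟩ := diracSym_coord ξ v
  obtain ⟨k0, k1, k2, k3⟩ := diracSym_coord ξ w
  simp only [PiLp.inner_apply, Fin.sum_univ_four, h0, h1, h2, h3, k0, k1, k2, k3,
    RCLike.inner_apply, map_add, map_sub, map_mul, map_neg, conj_ofReal, conj_I]
  ring

theorem tix_weighted_le {s N c K a b a' b' : ℝ} (hsN : N ≤ s) (hc : 0 ≤ c) (hc1 : c ≤ 1)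
    (hK : s + c ^ 2 * N ≤ K * (1 + c ^ 2)) (ha : 0 ≤ a) (hb : 0 ≤ b)
    (ha' : a' = c ^ 2 * b) (hb' : b' = c ^ 2 * a) :
    s * (a + a') + N * (b + b') ≤ K * ((a + a') + (b + b')) := by
  subst ha' hb'
  have h1 : N + c ^ 2 * s ≤ s + c ^ 2 * N := by
    nlinarith [mul_nonneg (sub_nonneg.2 hsN) (sub_nonneg.2 (pow_le_one₀ hc hc1 : c ^ 2 ≤ 1))]
  nlinarith [mul_le_mul_of_nonneg_right hK ha, mul_le_mul_of_nonneg_right (h1.trans hK) hb]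

theorem norm_sq_parts_of_eigen {ξ : V3} {x y : C4} {ρ : ℝ} (hx : diracSym ξ x = (ρ : ℂ) • x)
    (hy : diracSym (-ξ) y = (ρ : ℂ) • y) {e o : C4} (he : e = (1 / 2 : ℂ) • (x + y))
    (ho : o = (1 / 2 : ℂ) • (x - y)) :
    (2 * Real.pi * ‖ξ‖) ^ 2 * (‖o 0‖ ^ 2 + ‖o 1‖ ^ 2) = (ρ + 1) ^ 2 * (‖e 2‖ ^ 2 + ‖e 3‖ ^ 2) ∧
    (2 * Real.pi * ‖ξ‖) ^ 2 * (‖o 2‖ ^ 2 + ‖o 3‖ ^ 2) = (ρ - 1) ^ 2 * (‖e 0‖ ^ 2 + ‖e 1‖ ^ 2) := by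
  obtain ⟨h0, h1, h2, h3⟩ := diracSym_coord ξ x
  obtain ⟨k0, k1, k2, k3⟩ := diracSym_coord (-ξ) y
  have hξ : ∀ j, ((2 * Real.pi * (-ξ) j : ℝ) : ℂ) = -((2 * Real.pi * ξ j : ℝ) : ℂ) := fun j => by
    rw [PiLp.neg_apply, mul_neg, ofReal_neg]
  simp only [hx, hy, hξ, PiLp.smul_apply, smul_eq_mul] at h0 h1 h2 h3 k0 k1 k2 k3
  have e0 : ∀ j, e j = (1 / 2 : ℂ) * (x j + y j) := fun j => by rw [he]; simp; ring
  have o0 : ∀ j, o j = (1 / 2 : ℂ) * (x j - y j) := fun j => by rw [ho]; simp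
  have hn : ∀ (r : ℝ) (a b : ℂ), r ^ 2 * (‖a‖ ^ 2 + ‖b‖ ^ 2) =
      ‖(r : ℂ) * a‖ ^ 2 + ‖(r : ℂ) * b‖ ^ 2 :=
    fun r a b => by
      rw [norm_mul, norm_mul, norm_real, Real.norm_eq_abs, mul_pow, mul_pow, sq_abs, mul_add]
  rw [norm_sq_eq_coord, ← norm_sq_pauli_mul, ← norm_sq_pauli_mul, hn, hn]
  refine ⟨?_, ?_⟩
  · congr 3
    · rw [o0, o0, e0]
      push_cast at *
      linear_combination -(h2 + k2) / 2
    · rw [o0, o0, e0]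
      push_cast at *
      linear_combination -(h3 + k3) / 2
  · congr 3
    · rw [o0, o0, e0]
      push_cast at *
      linear_combination -(h0 + k0) / 2
    · rw [o0, o0, e0]
      push_cast at *
      linear_combination -(h1 + k1) / 2

theorem c4_norm_sq (v : C4) : ‖v‖ ^ 2 = (‖v 0‖ ^ 2 + ‖v 1‖ ^ 2) + (‖v 2‖ ^ 2 + ‖v 3‖ ^ 2) := by
  rw [EuclideanSpace.norm_sq_eq, Fin.sum_univ_four]
  ring

theorem tix_pointwise {ξ : V3} (hξ : ξ ≠ 0) {x y : C4} {ρ : ℝ}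
    (hρ : ρ = energy ξ ∨ ρ = -energy ξ) (hx : diracSym ξ x = (ρ : ℂ) • x)
    (hy : diracSym (-ξ) y = (ρ : ℂ) • y) :
    evenWt (2 * Real.pi * ‖ξ‖) * ‖(1 / 2 : ℂ) • (x + y)‖ ^ 2 +
      oddWt (2 * Real.pi * ‖ξ‖) * ‖(1 / 2 : ℂ) • (x - y)‖ ^ 2 ≤
    tixConst * energy ξ * (‖(1 / 2 : ℂ) • (x + y)‖ ^ 2 + ‖(1 / 2 : ℂ) • (x - y)‖ ^ 2) := by
  obtain ⟨h1, h2⟩ := norm_sq_parts_of_eigen hx hy rfl rfl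
  have hx' : diracSym ξ x = (ρ : ℂ) • x := hx
  have hy' : diracSym (-ξ) (-y) = (ρ : ℂ) • -y := by rw [map_neg, hy, smul_neg]
  obtain ⟨h3, h4⟩ := norm_sq_parts_of_eigen hx' hy' (e := (1 / 2 : ℂ) • (x - y))
    (o := (1 / 2 : ℂ) • (x + y)) (by rw [sub_eq_add_neg]) (by rw [sub_neg_eq_add])
  set e := (1 / 2 : ℂ) • (x + y)
  set o := (1 / 2 : ℂ) • (x - y)
  have hp : 0 < 2 * Real.pi * ‖ξ‖ := by
    have := norm_pos_iff.2 hξ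
    have := Real.pi_pos
    positivity
  have hE := energy_sq ξ
  have hE0 := one_le_energy ξ
  have hK := evenWt_add_le hp
  change _ ≤ tixConst * energy ξ * _ at hK
  have hNs := oddWt_le_evenWt hp
  rw [show √(1 + (2 * Real.pi * ‖ξ‖) ^ 2) = energy ξ from rfl] at hK
  set p := 2 * Real.pi * ‖ξ‖
  have hc : 0 ≤ p / (energy ξ + 1) := by positivity
  have hc1 : p / (energy ξ + 1) ≤ 1 := by
    rw [div_le_one (by linarith)]
    nlinarith
  have key : ∀ a b : ℝ, p ^ 2 * a = (energy ξ + 1) ^ 2 * b → b = (p / (energy ξ + 1)) ^ 2 * a := by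
    intro a b h
    have : energy ξ + 1 ≠ 0 := by linarith
    field_simp
    linarith
  rw [c4_norm_sq e, c4_norm_sq o]
  rcases hρ with rfl | rfl
  · have := tix_weighted_le hNs hc hc1 hK (a := ‖e 0‖ ^ 2 + ‖e 1‖ ^ 2)
      (b := ‖o 0‖ ^ 2 + ‖o 1‖ ^ 2) (by positivity) (by positivity) (key _ _ h1) (key _ _ h3)
    exact this
  · have h2' := key (‖o 2‖ ^ 2 + ‖o 3‖ ^ 2) (‖e 0‖ ^ 2 + ‖e 1‖ ^ 2) (by rw [h2]; ring)
    have h4' := key (‖e 2‖ ^ 2 + ‖e 3‖ ^ 2) (‖o 0‖ ^ 2 + ‖o 1‖ ^ 2) (by rw [h4]; ring)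
    have := tix_weighted_le hNs hc hc1 hK (a := ‖e 2‖ ^ 2 + ‖e 3‖ ^ 2)
      (b := ‖o 2‖ ^ 2 + ‖o 3‖ ^ 2) (by positivity) (by positivity) h2' h4'
    linarith

theorem coulombEnergy_le_tix {f : V3 → C4} (hf : Integrable f) (hm : Measurable f)
    {ρ : V3 → ℝ} (hρ : (∀ ξ, ρ ξ = energy ξ) ∨ ∀ ξ, ρ ξ = -energy ξ)
    (hD : ∀ᵐ ξ, diracSym ξ (f ξ) = (ρ ξ : ℂ) • f ξ) :
    coulombEnergy f ≤ ∫⁻ ξ, ENNReal.ofReal (tixConst * energy ξ) * ‖f ξ‖ₑ ^ 2 := by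
  have hneg : MeasurePreserving (LinearIsometryEquiv.neg ℝ : V3 ≃ₗᵢ[ℝ] V3) volume volume :=
    LinearIsometryEquiv.measurePreserving _
  have hw : Measurable fun ξ => ENNReal.ofReal (tixConst * energy ξ) :=
    (continuous_energy.measurable.const_mul _).ennreal_ofReal
  have ht : 0 ≤ tixConst := by
    unfold tixConst
    have := Real.pi_pos
    positivity
  refine (coulombEnergy_le hf hm).trans ?_
  simp only [mul_comm (ENNReal.ofReal (tixConst * _))]
  rw [lintegral_enorm_sq_split (A := LinearIsometryEquiv.neg ℝ) hm hw fun ξ => by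
    rw [show (LinearIsometryEquiv.neg ℝ : V3 ≃ₗᵢ[ℝ] V3) ξ = -ξ from rfl, energy_neg]]
  have hsm : Measurable (symmPart (LinearIsometryEquiv.neg ℝ) f) := measurable_symmPart hm
  rw [← lintegral_add_left (by fun_prop)]
  refine lintegral_mono_ae ?_
  filter_upwards [hD, hneg.quasiMeasurePreserving.ae hD, Measure.ae_ne volume (0 : V3)]
    with ξ h1 h2 h0
  have h2' : diracSym (-ξ) (f (-ξ)) = (ρ ξ : ℂ) • f (-ξ) := by
    have h3 : diracSym (-ξ) (f (-ξ)) = (ρ (-ξ) : ℂ) • f (-ξ) := h2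
    rw [h3]
    rcases hρ with h | h <;> simp only [h, energy_neg]
  have h := tix_pointwise h0 (hρ.imp (fun h => h ξ) fun h => h ξ) h1 h2'
  have hp : 0 < 2 * Real.pi * ‖ξ‖ := by
    have := norm_pos_iff.2 h0
    have := Real.pi_pos
    positivity
  have hE := (energy_pos ξ).le
  have hN := oddWt_nonneg hp.le
  have hs := hN.trans (oddWt_le_evenWt hp)
  have h' := ENNReal.ofReal_le_ofReal h
  rw [mul_add, ENNReal.ofReal_add (by positivity) (by positivity),
    ENNReal.ofReal_add (by positivity) (by positivity), ENNReal.ofReal_mul hs,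
    ENNReal.ofReal_mul hN, ENNReal.ofReal_mul (p := tixConst * energy ξ) (by positivity),
    ENNReal.ofReal_mul (p := tixConst * energy ξ) (by positivity),
    ENNReal.ofReal_pow (norm_nonneg _), ENNReal.ofReal_pow (norm_nonneg _), ofReal_norm,
    ofReal_norm] at h'
  rw [mul_comm _ (ENNReal.ofReal (tixConst * _)), mul_comm _ (ENNReal.ofReal (tixConst * _))]
  exact h'

theorem memLp_symbol {S : V3 → C4 →L[ℂ] C4} (hS : Continuous S) (hb : ∀ ξ, ‖S ξ‖ ≤ 1) (u : DSp) :
    MemLp (fun ξ => S ξ (u ξ)) 2 volume := by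
  refine (Lp.memLp u).of_le ?_ (Eventually.of_forall fun ξ => ?_)
  · exact (ContinuousLinearMap.apply ℂ C4).flip.aestronglyMeasurable_comp₂
      hS.aestronglyMeasurable (Lp.aestronglyMeasurable u)
  · exact ((S ξ).le_of_opNorm_le (hb ξ) _).trans_eq (one_mul _)

/-- Multiplication by a continuous contraction-valued symbol. -/
def symbolMul (S : V3 → C4 →L[ℂ] C4) (hS : Continuous S) (hb : ∀ ξ, ‖S ξ‖ ≤ 1) :
    DSp →L[ℂ] DSp :=
  LinearMap.mkContinuous
    { toFun := fun u => (memLp_symbol hS hb u).toLp _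
      map_add' := fun u v => by
        rw [← MemLp.toLp_add]
        refine MemLp.toLp_congr _ _ ?_
        filter_upwards [Lp.coeFn_add u v] with ξ h
        exact (congrArg (S ξ) h).trans (map_add _ _ _)
      map_smul' := fun c u => by
        rw [RingHom.id_apply, ← MemLp.toLp_const_smul]
        refine MemLp.toLp_congr _ _ ?_
        filter_upwards [Lp.coeFn_smul c u] with ξ h
        exact (congrArg (S ξ) h).trans ((S ξ).map_smul c (u ξ)) } 1 fun u => by
    rw [one_mul]
    refine Lp.norm_le_norm_of_ae_le ?_
    filter_upwards [(memLp_symbol hS hb u).coeFn_toLp] with ξ h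
    refine (congrArg norm h).trans_le ?_
    exact ((S ξ).le_of_opNorm_le (hb ξ) _).trans_eq (one_mul _)

theorem symbolMul_ae {S : V3 → C4 →L[ℂ] C4} (hS : Continuous S) (hb : ∀ ξ, ‖S ξ‖ ≤ 1) (u : DSp) :
    ∀ᵐ ξ, symbolMul S hS hb u ξ = S ξ (u ξ) :=
  (memLp_symbol hS hb u).coeFn_toLp

theorem symbolMul_eq {S : V3 → C4 →L[ℂ] C4} (hS : Continuous S) (hb : ∀ ξ, ‖S ξ‖ ≤ 1) {u v : DSp}
    (h : ∀ᵐ ξ, v ξ = S ξ (u ξ)) : symbolMul S hS hb u = v := by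
  refine Lp.ext ?_
  filter_upwards [symbolMul_ae hS hb u, h] with ξ h1 h2
  rw [h1, h2]

theorem symbolMul_mul_eq {S T U W : V3 → C4 →L[ℂ] C4} (hS : Continuous S) (hbS : ∀ ξ, ‖S ξ‖ ≤ 1)
    (hT : Continuous T) (hbT : ∀ ξ, ‖T ξ‖ ≤ 1) (hU : Continuous U) (hbU : ∀ ξ, ‖U ξ‖ ≤ 1)
    (hW : Continuous W) (hbW : ∀ ξ, ‖W ξ‖ ≤ 1) (h : ∀ ξ v, S ξ (T ξ v) = U ξ (W ξ v)) :
    symbolMul S hS hbS * symbolMul T hT hbT = symbolMul U hU hbU * symbolMul W hW hbW := by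
  refine ContinuousLinearMap.ext fun u => ?_
  change symbolMul S hS hbS (symbolMul T hT hbT u) = symbolMul U hU hbU (symbolMul W hW hbW u)
  refine symbolMul_eq hS hbS ?_
  filter_upwards [symbolMul_ae hT hbT u, symbolMul_ae hW hbW u,
    symbolMul_ae hU hbU (symbolMul W hW hbW u)] with ξ h1 h2 h3
  rw [h1, h, ← h2, ← h3]

theorem isSymmetric_symbolMul {S : V3 → C4 →L[ℂ] C4} (hS : Continuous S) (hb : ∀ ξ, ‖S ξ‖ ≤ 1)
    (h : ∀ ξ v w, inner ℂ (S ξ v) w = inner ℂ v (S ξ w)) (u v : DSp) :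
    inner ℂ (symbolMul S hS hb u) v = inner ℂ u (symbolMul S hS hb v) := by
  rw [L2.inner_def, L2.inner_def]
  refine integral_congr_ae ?_
  filter_upwards [symbolMul_ae hS hb u, symbolMul_ae hS hb v] with ξ h1 h2
  rw [h1, h2, h]

theorem re_inner_symbolMul_nonneg {S : V3 → C4 →L[ℂ] C4} (hS : Continuous S)
    (hb : ∀ ξ, ‖S ξ‖ ≤ 1) (h : ∀ ξ v, 0 ≤ (inner ℂ (S ξ v) v).re) (u : DSp) :
    0 ≤ (inner ℂ (symbolMul S hS hb u) u).re := by
  rw [L2.inner_def]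
  have := integral_re (L2.integrable_inner (𝕜 := ℂ) (symbolMul S hS hb u) u)
  rw [show ∀ z : ℂ, z.re = RCLike.re z from fun _ => rfl, ← this]
  refine integral_nonneg_of_ae ?_
  filter_upwards [symbolMul_ae hS hb u] with ξ h1
  rw [h1]
  exact h ξ _

theorem norm_real_smul_one_le {c : ℝ} (h0 : 0 ≤ c) (h1 : c ≤ 1) :
    ‖(c : ℂ) • (1 : C4 →L[ℂ] C4)‖ ≤ 1 := by
  rw [norm_smul, norm_real, Real.norm_of_nonneg h0]
  exact mul_le_one₀ h1 (norm_nonneg _) ContinuousLinearMap.norm_id_le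

theorem energy_inv_mem (ξ : V3) : 0 ≤ (energy ξ)⁻¹ ∧ (energy ξ)⁻¹ ≤ 1 :=
  ⟨inv_nonneg.2 (energy_pos ξ).le, inv_le_one_of_one_le₀ (one_le_energy ξ)⟩

theorem continuous_energy_inv : Continuous fun ξ => (energy ξ)⁻¹ :=
  continuous_energy.inv₀ fun ξ => ne_of_gt (energy_pos ξ)

/-- The symbol of `|H₀|⁻¹`. -/
def absSym (ξ : V3) : C4 →L[ℂ] C4 := (((energy ξ)⁻¹ : ℝ) : ℂ) • 1

/-- The symbol of `|H₀|^{-1/2}`. -/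
def sqrtSym (ξ : V3) : C4 →L[ℂ] C4 := ((√(energy ξ)⁻¹ : ℝ) : ℂ) • 1

/-- The symbol of `H₀⁻¹`. -/
def resSym (ξ : V3) : C4 →L[ℂ] C4 := (((energy ξ)⁻¹ ^ 2 : ℝ) : ℂ) • diracSym ξ

theorem continuous_absSym : Continuous absSym :=
  (continuous_ofReal.comp continuous_energy_inv).smul continuous_const

theorem continuous_sqrtSym : Continuous sqrtSym :=
  (continuous_ofReal.comp continuous_energy_inv.sqrt).smul continuous_const

theorem continuous_resSym : Continuous resSym :=
  (continuous_ofReal.comp (continuous_energy_inv.pow 2)).smul continuous_diracSym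

theorem norm_absSym_le (ξ : V3) : ‖absSym ξ‖ ≤ 1 :=
  norm_real_smul_one_le (energy_inv_mem ξ).1 (energy_inv_mem ξ).2

theorem norm_sqrtSym_le (ξ : V3) : ‖sqrtSym ξ‖ ≤ 1 :=
  norm_real_smul_one_le (Real.sqrt_nonneg _) (Real.sqrt_le_one.2 (energy_inv_mem ξ).2)

theorem norm_diracSym_apply (ξ : V3) (v : C4) : ‖diracSym ξ v‖ = energy ξ * ‖v‖ := by
  have h : (inner ℂ (diracSym ξ v) (diracSym ξ v) : ℂ) = ((energy ξ * ‖v‖ : ℝ) : ℂ) ^ 2 := by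
    rw [inner_diracSym, diracSym_diracSym, inner_smul_right, inner_self_eq_norm_sq_to_K]
    push_cast
    rw [mul_pow]
    rfl
  rw [inner_self_eq_norm_sq_to_K] at h
  have h' : ‖diracSym ξ v‖ ^ 2 = (energy ξ * ‖v‖) ^ 2 := by exact_mod_cast (congrArg re h)
  exact (sq_eq_sq₀ (norm_nonneg _) (mul_nonneg (energy_pos ξ).le (norm_nonneg _))).1 h'

theorem norm_resSym_le (ξ : V3) : ‖resSym ξ‖ ≤ 1 := by
  refine ContinuousLinearMap.opNorm_le_bound _ zero_le_one fun v => ?_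
  rw [resSym, _root_.smul_apply, norm_smul, norm_real, norm_diracSym_apply,
    Real.norm_of_nonneg (by positivity), ← mul_assoc]
  refine mul_le_mul_of_nonneg_right ?_ (norm_nonneg _)
  have := energy_pos ξ
  calc (energy ξ)⁻¹ ^ 2 * energy ξ = (energy ξ)⁻¹ := by field_simp
    _ ≤ 1 := (energy_inv_mem ξ).2

/-- Multiplication by the symbol of `|H₀|⁻¹`. -/
def absMul : DSp →L[ℂ] DSp := symbolMul absSym continuous_absSym norm_absSym_le

/-- Multiplication by the symbol of `|H₀|^{-1/2}`. -/
def sqrtMul : DSp →L[ℂ] DSp := symbolMul sqrtSym continuous_sqrtSym norm_sqrtSym_le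

/-- Multiplication by the symbol of `H₀⁻¹`. -/
def resMul : DSp →L[ℂ] DSp := symbolMul resSym continuous_resSym norm_resSym_le

theorem resMul_mul_resMul : resMul * resMul = absMul * absMul := by
  refine symbolMul_mul_eq _ _ _ _ _ _ _ _ fun ξ v => ?_
  have hE := (energy_pos ξ).ne'
  simp only [resSym, absSym, _root_.smul_apply, map_smul, diracSym_diracSym,
    smul_smul, _root_.one_apply_eq_self]
  congr 1
  norm_cast
  field_simp

theorem sqrtMul_mul_sqrtMul : sqrtMul * sqrtMul = absMul := by
  refine ContinuousLinearMap.ext fun u => ?_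
  change sqrtMul (sqrtMul u) = absMul u
  refine symbolMul_eq continuous_sqrtSym norm_sqrtSym_le ?_
  filter_upwards [symbolMul_ae continuous_sqrtSym norm_sqrtSym_le u,
    symbolMul_ae continuous_absSym norm_absSym_le u] with ξ h1 h2
  refine h2.trans ?_
  rw [sqrtMul, h1]
  simp only [sqrtSym, absSym, _root_.smul_apply,
    smul_smul, _root_.one_apply_eq_self]
  congr 1
  norm_cast
  exact (Real.mul_self_sqrt (energy_inv_mem ξ).1).symm

theorem inner_resMul (u v : DSp) : inner ℂ (resMul u) v = inner ℂ u (resMul v) := by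
  refine isSymmetric_symbolMul _ _ (fun ξ v w => ?_) u v
  rw [resSym, _root_.smul_apply, _root_.smul_apply, inner_smul_left,
    inner_smul_right, conj_ofReal, inner_diracSym]

theorem nonneg_symbolMul_of_real {S : V3 → C4 →L[ℂ] C4} (hS : Continuous S) (hb : ∀ ξ, ‖S ξ‖ ≤ 1)
    {c : V3 → ℝ} (hc : ∀ ξ, 0 ≤ c ξ) (h : ∀ ξ, S ξ = (c ξ : ℂ) • 1) : 0 ≤ symbolMul S hS hb := by
  rw [ContinuousLinearMap.nonneg_iff_isPositive]
  refine ⟨fun u v => isSymmetric_symbolMul hS hb (fun ξ v w => ?_) u v, fun u =>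
    re_inner_symbolMul_nonneg hS hb (fun ξ v => ?_) u⟩
  · simp [h]
  · rw [h, _root_.smul_apply, inner_smul_left, _root_.one_apply_eq_self,
      inner_self_eq_norm_sq_to_K, conj_ofReal]
    have := hc ξ
    have h2 : (0 : ℝ) ≤ c ξ * ‖v‖ ^ 2 := by positivity
    refine h2.trans_eq ?_
    rw [re_ofReal_mul]
    norm_cast

theorem absMul_nonneg : 0 ≤ absMul :=
  nonneg_symbolMul_of_real _ _ (fun ξ => (energy_inv_mem ξ).1) fun _ => rfl

theorem sqrtMul_nonneg : 0 ≤ sqrtMul :=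
  nonneg_symbolMul_of_real _ _ (fun _ => Real.sqrt_nonneg _) fun _ => rfl

/-- The Fourier transform on `L²(ℝ³, ℂ⁴)`. -/
abbrev fourierL2 : DSp ≃ₗᵢ[ℂ] DSp := Lp.fourierTransformₗᵢ V3 C4

open scoped SchwartzMap FourierTransform in
theorem fourier_postcompCLM (L : C4 →L[ℂ] C4) (φ : 𝓢(V3, C4)) (ξ : V3) :
    𝓕 (φ.postcompCLM L) ξ = L (𝓕 φ ξ) := by
  rw [SchwartzMap.fourier_coe, SchwartzMap.fourier_coe, Real.fourier_eq, Real.fourier_eq,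
    ← L.integral_comp_comm]
  · simp [Circle.smul_def]
  · exact (Real.fourierIntegral_convergent_iff ξ).2 φ.integrable

open scoped SchwartzMap FourierTransform LineDeriv in
theorem fourier_diracAct_schwartz (φ : 𝓢(V3, C4)) :
    ∃ ψ : 𝓢(V3, C4), (∀ x, ψ x = diracAct φ x) ∧ ∀ ξ, 𝓕 ψ ξ = diracSym ξ (𝓕 φ ξ) := by
  refine ⟨φ.postcompCLM (mappCLM diracβ) - I • ∑ j : Fin 3,
    (∂_{(EuclideanSpace.single j (1 : ℝ) : V3)} φ).postcompCLM (mappCLM (diracα j)), fun x => ?_,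
    fun ξ => ?_⟩
  · simp [diracAct, SchwartzMap.lineDerivOp_apply_eq_fderiv, mappCLM_apply]
  · rw [sub_eq_add_neg, FourierTransform.fourier_add, FourierTransform.fourier_neg,
      FourierTransform.fourier_smul, FourierTransform.fourier_sum, diracSym_apply]
    simp only [_root_.add_apply, _root_.neg_apply, _root_.smul_apply,
      _root_.sum_apply, fourier_postcompCLM, mappCLM_apply, Finset.smul_sum,
      ← Finset.sum_neg_distrib]
    congr 1
    refine Finset.sum_congr rfl fun j _ => ?_
    rw [SchwartzMap.fourier_lineDerivOp_eq]
    have : (inner ℝ · (EuclideanSpace.single j (1 : ℝ) : V3)).HasTemperateGrowth :=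
      ((innerSL ℝ).flip _).hasTemperateGrowth
    rw [_root_.smul_apply, SchwartzMap.smulLeftCLM_apply_apply this, ← mappCLM_apply,
      map_smul, ← coe_smul, map_smul, smul_smul, smul_smul, ← neg_smul]
    rw [EuclideanSpace.inner_single_right]
    congr 1
    simp
    linear_combination (-2 * Real.pi * ξ j : ℂ) * I_sq

open scoped SchwartzMap FourierTransform in
theorem fourierL2_of_testFn {f : V3 → C4} (hf : IsTestFn f) {u v : DSp} (hu : ⇑u =ᵐ[volume] f)
    (hv : ⇑v =ᵐ[volume] fun x => diracAct f x) : resMul (fourierL2 v) = fourierL2 u := by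
  obtain ⟨ψ, hψ, hD⟩ := fourier_diracAct_schwartz (hf.2.toSchwartzMap hf.1)
  have hu' : u = (hf.2.toSchwartzMap hf.1).toLp 2 := by
    exact Lp.ext (hu.trans (SchwartzMap.coeFn_toLp (hf.2.toSchwartzMap hf.1) 2 volume).symm)
  have hv' : v = ψ.toLp 2 := by
    refine Lp.ext (hv.trans ?_)
    filter_upwards [SchwartzMap.coeFn_toLp ψ 2 volume] with x hx
    rw [hx, hψ]
    rfl
  have h1 : fourierL2 u = (𝓕 (hf.2.toSchwartzMap hf.1)).toLp 2 := by
    rw [hu', ← SchwartzMap.toLp_fourier_eq]; rfl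
  have h2 : fourierL2 v = (𝓕 ψ).toLp 2 := by
    rw [hv', ← SchwartzMap.toLp_fourier_eq]; rfl
  refine symbolMul_eq continuous_resSym norm_resSym_le ?_
  rw [h1, h2]
  filter_upwards [SchwartzMap.coeFn_toLp (𝓕 ψ) 2 volume,
    SchwartzMap.coeFn_toLp (𝓕 (hf.2.toSchwartzMap hf.1)) 2 volume] with ξ h3 h4
  rw [h3, h4, hD, resSym, _root_.smul_apply, diracSym_diracSym, smul_smul]
  have := (energy_pos ξ).ne'
  rw [← ofReal_mul, ← mul_pow, inv_mul_cancel₀ this, one_pow, ofReal_one, one_smul]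

theorem fourierL2_resolvent {H0 : DSp →ₗ.[ℂ] DSp} (hH0 : IsFreeDirac H0) {R : DSp →L[ℂ] DSp}
    (hR : IsResolventAt H0 0 R) (y : DSp) : fourierL2 (R y) = resMul (fourierL2 y) := by
  obtain ⟨-, ⟨hle, hcore⟩, htest⟩ := hH0
  have hclosed : IsClosed {p : DSp × DSp | resMul (fourierL2 p.2) = fourierL2 p.1} :=
    isClosed_eq (by fun_prop) (by fun_prop)
  have hspan : ∀ u ∈ testSub, ∀ hu : u ∈ H0.domain,
      resMul (fourierL2 (H0 ⟨u, hu⟩)) = fourierL2 u := by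
    intro u hu
    induction hu using Submodule.span_induction with
    | mem u h =>
      intro hu
      obtain ⟨f, hf, huf⟩ := h
      obtain ⟨_, h⟩ := htest u f hf huf
      exact fourierL2_of_testFn hf huf h
    | zero =>
      intro hu
      rw [show (⟨0, hu⟩ : H0.domain) = 0 from rfl]
      simp
    | add a b ha hb iha ihb =>
      intro hu
      have hu' : (⟨a + b, hu⟩ : H0.domain) = ⟨a, hle ha⟩ + ⟨b, hle hb⟩ := rfl
      rw [hu', H0.map_add, map_add, map_add, iha, ihb, map_add]
    | smul c a ha iha =>
      intro hu
      have hu' : (⟨c • a, hu⟩ : H0.domain) = c • ⟨a, hle ha⟩ := rfl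
      rw [hu', H0.map_smul, map_smul, map_smul, iha, map_smul]
  have hgraph : ((H0.domRestrict testSub).graph : Set (DSp × DSp)) ⊆
      {p : DSp × DSp | resMul (fourierL2 p.2) = fourierL2 p.1} := by
    rintro ⟨a, b⟩ hab
    obtain ⟨⟨z, hz⟩, h1, h2⟩ := (LinearPMap.mem_graph_iff _).1 hab
    have h3 : H0 ⟨z, hz.2⟩ = b := h2
    change resMul (fourierL2 b) = fourierL2 a
    have h1 : z = a := h1
    subst h1
    rw [← h3]
    exact hspan z hz.1 hz.2
  have hH0 : (H0.graph : Set (DSp × DSp)) ⊆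
      {p : DSp × DSp | resMul (fourierL2 p.2) = fourierL2 p.1} := by
    by_cases hc : (H0.domRestrict testSub).IsClosable
    · rw [← hcore, ← hc.graph_closure_eq_closure_graph, Submodule.topologicalClosure_coe]
      exact closure_minimal hgraph hclosed
    · rw [← hcore, LinearPMap.closure_def' hc]
      exact hgraph
  obtain ⟨hy, hRy⟩ := hR.2 y
  rw [zero_smul, sub_zero] at hRy
  have hmem : (R y, y) ∈ H0.graph := (LinearPMap.mem_graph_iff _).2 ⟨⟨R y, hy⟩, rfl, hRy⟩
  exact (hH0 hmem).symm

theorem conjStarAlgEquiv_nonneg {H : Type*} [NormedAddCommGroup H] [InnerProductSpace ℂ H]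
    [CompleteSpace H] (e : H ≃ₗᵢ[ℂ] H) {T : H →L[ℂ] H} (hT : 0 ≤ T) : 0 ≤ e.conjStarAlgEquiv T :=
  map_nonneg e.conjStarAlgEquiv hT

/-- The Fourier multiplier with symbol `T`. -/
abbrev fourierMul (T : DSp →L[ℂ] DSp) : DSp →L[ℂ] DSp := fourierL2.symm.conjStarAlgEquiv T

theorem fourierMul_apply (T : DSp →L[ℂ] DSp) (u : DSp) :
    fourierMul T u = fourierL2.symm (T (fourierL2 u)) := rfl

theorem absCLM_fourierMul_resMul : absCLM (fourierMul resMul) = fourierMul absMul := by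
  refine CFC.sqrt_unique ?_ (conjStarAlgEquiv_nonneg _ absMul_nonneg)
  rw [← map_mul, ← map_mul, resMul_mul_resMul]

theorem invSqrtAbs_fourierMul_resMul : invSqrtAbs (fourierMul resMul) = fourierMul sqrtMul := by
  rw [invSqrtAbs, absCLM_fourierMul_resMul]
  refine CFC.sqrt_unique ?_ (conjStarAlgEquiv_nonneg _ sqrtMul_nonneg)
  rw [← map_mul, sqrtMul_mul_sqrtMul]

theorem resolvent_eq_fourierMul {H0 : DSp →ₗ.[ℂ] DSp} (hH0 : IsFreeDirac H0) {R : DSp →L[ℂ] DSp}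
    (hR : IsResolventAt H0 0 R) : R = fourierMul resMul := by
  refine ContinuousLinearMap.ext fun y => ?_
  rw [fourierMul_apply, ← fourierL2_resolvent hH0 hR, LinearIsometryEquiv.symm_apply_apply]

theorem sqrtMul_injective {v : DSp} (h : sqrtMul v = 0) : v = 0 := by
  refine Lp.ext ?_
  filter_upwards [symbolMul_ae continuous_sqrtSym norm_sqrtSym_le v,
    Lp.coeFn_zero C4 2 (volume : Measure V3)] with ξ h1 h2
  change sqrtMul v ξ = _ at h1
  rw [h, h2, sqrtSym, _root_.smul_apply, _root_.one_apply_eq_self] at h1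
  rw [h2]
  have hE : ((√(energy ξ)⁻¹ : ℝ) : ℂ) ≠ 0 :=
    ofReal_ne_zero.2 (Real.sqrt_pos.2 (inv_pos.2 (energy_pos ξ))).ne'
  exact (smul_eq_zero.1 h1.symm).resolve_left hE

theorem eq_apply_pApply_pinv {H : Type*} [NormedAddCommGroup H] [InnerProductSpace ℂ H]
    [CompleteSpace H] {J : H →L[ℂ] H} (hJ : ∀ v, J v = 0 → v = 0) {u : H}
    (hu : u ∈ (pinv J).domain) : J (pApply (pinv J) u) = u := by
  have hg : ∀ x : H × H, x ∈ (LinearMap.graph (J : H →ₗ[ℂ] H)).map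
      ((LinearEquiv.prodComm ℂ H H) : H × H →ₗ[ℂ] H × H) → x.1 = 0 → x.2 = 0 := by
    rintro _ ⟨⟨a, b⟩, hab, rfl⟩ hx
    have hab' : b = J a := hab
    have hx' : b = 0 := hx
    exact hJ a (hab' ▸ hx')
  have hm := Submodule.mem_graph_toLinearPMap hg ⟨u, hu⟩
  obtain ⟨⟨a, b⟩, hab, h⟩ := hm
  have hab' : b = J a := hab
  rw [pApply, dif_pos hu]
  have h1 : b = u := congrArg Prod.fst h
  have h2 : a = pinv J ⟨u, hu⟩ := congrArg Prod.snd h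
  rw [← h2, ← hab', h1]

theorem mul_sub_eq_absCLM {H : Type*} [NormedAddCommGroup H] [InnerProductSpace ℂ H]
    [CompleteSpace H] {R Pp Pm : H →L[ℂ] H} (hR : IsSelfAdjoint R) (hP : IsPosNegPair R Pp Pm) :
    R * (Pp - Pm) = absCLM R := by
  obtain ⟨h1, hp, hm, hpp, hmm, hc, hpos, hneg⟩ := hP
  have hPm : Pm = 1 - Pp := eq_sub_of_add_eq' h1
  have hcm : Pm * R = R * Pm := by rw [hPm, sub_mul, mul_sub, hc, one_mul, mul_one]
  have hpm : Pp * Pm = 0 := by rw [hPm, mul_sub, mul_one, hpp.eq, sub_self]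
  have hmp : Pm * Pp = 0 := by rw [hPm, sub_mul, one_mul, hpp.eq, sub_self]
  have hcd : (Pp - Pm) * R = R * (Pp - Pm) := by rw [sub_mul, mul_sub, hc, hcm]
  have hdd : (Pp - Pm) * (Pp - Pm) = 1 := by
    rw [sub_mul, mul_sub, mul_sub, hpm, hmp, hpp.eq, hmm.eq, ← h1]
    abel
  refine (CFC.sqrt_unique ?_ ?_).symm
  · rw [mul_assoc, ← mul_assoc (Pp - Pm), hcd, mul_assoc, hdd, mul_one]
  · rw [ContinuousLinearMap.nonneg_iff_isPositive]
    have hsa : IsSelfAdjoint (R * (Pp - Pm)) := (hR.commute_iff (hp.sub hm)).1 hcd.symm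
    refine ⟨ContinuousLinearMap.isSelfAdjoint_iff_isSymmetric.1 hsa, fun x => ?_⟩
    have e : R * (Pp - Pm) = Pp * R * Pp - Pm * R * Pm := by
      rw [hc, hcm, mul_assoc, mul_assoc, hpp.eq, hmm.eq, mul_sub]
    have e1 : inner ℂ ((R * (Pp - Pm)) x) x =
        inner ℂ (R (Pp x)) (Pp x) - inner ℂ (R (Pm x)) (Pm x) := by
      rw [e, _root_.sub_apply, inner_sub_left]
      congr 1
      · exact ContinuousLinearMap.isSelfAdjoint_iff_isSymmetric.1 hp _ _
      · exact ContinuousLinearMap.isSelfAdjoint_iff_isSymmetric.1 hm _ _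
    change 0 ≤ (inner ℂ ((R * (Pp - Pm)) x) x).re
    have h2 := hpos x
    have h3 := hneg x
    rw [← inner_conj_symm, conj_re] at h2 h3
    rw [e1, sub_re]
    linarith

theorem diracSym_fourierL2 {Pp Pm : DSp →L[ℂ] DSp} (hP : IsPosNegPair (fourierMul resMul) Pp Pm)
    {u : DSp} (hu : Pp u = u ∨ Pm u = u) :
    (∀ᵐ ξ, diracSym ξ (fourierL2 u ξ) = (energy ξ : ℂ) • fourierL2 u ξ) ∨
    ∀ᵐ ξ, diracSym ξ (fourierL2 u ξ) = ((-energy ξ : ℝ) : ℂ) • fourierL2 u ξ := by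
  have hsa : IsSelfAdjoint (fourierMul resMul) :=
    IsSelfAdjoint.map (ContinuousLinearMap.isSelfAdjoint_iff_isSymmetric.2 inner_resMul) _
  have h := mul_sub_eq_absCLM hsa hP
  rw [absCLM_fourierMul_resMul] at h
  have hu' := congrArg (fun T => fourierL2 (T u)) h
  change fourierL2 (fourierMul resMul (Pp u - Pm u)) = fourierL2 (fourierMul absMul u) at hu'
  rw [fourierMul_apply, fourierMul_apply, LinearIsometryEquiv.apply_symm_apply,
    LinearIsometryEquiv.apply_symm_apply] at hu'
  have hsum : Pp u + Pm u = u := congrArg (fun T => T u) hP.1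
  have h1 := symbolMul_ae continuous_resSym norm_resSym_le (fourierL2 u)
  have h2 := symbolMul_ae continuous_absSym norm_absSym_le (fourierL2 u)
  change ∀ᵐ ξ, resMul (fourierL2 u) ξ = _ at h1
  change ∀ᵐ ξ, absMul (fourierL2 u) ξ = _ at h2
  rcases hu with hu | hu
  · left
    rw [hu] at hsum hu'
    rw [add_eq_left.1 hsum, sub_zero] at hu'
    rw [hu'] at h1
    filter_upwards [h1, h2] with ξ h1 h2
    have hE : (energy ξ : ℂ) ≠ 0 := ofReal_ne_zero.2 (energy_pos ξ).ne'
    have h3 := congrArg (fun v => ((energy ξ : ℂ) ^ 2) • v) (h1.symm.trans h2)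
    simp only [resSym, absSym, _root_.smul_apply, _root_.one_apply_eq_self, smul_smul] at h3
    rw [show (energy ξ : ℂ) ^ 2 * (((energy ξ)⁻¹ ^ 2 : ℝ) : ℂ) = 1 by push_cast; field_simp,
      show (energy ξ : ℂ) ^ 2 * (((energy ξ)⁻¹ : ℝ) : ℂ) = energy ξ by push_cast; field_simp,
      one_smul] at h3
    exact h3
  · right
    rw [hu] at hsum hu'
    rw [add_eq_right.1 hsum, zero_sub, map_neg, map_neg] at hu'
    have hu2 : resMul (fourierL2 u) = -absMul (fourierL2 u) := by rw [← hu', neg_neg]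
    rw [hu2] at h1
    filter_upwards [h1, h2, Lp.coeFn_neg (absMul (fourierL2 u))] with ξ h1 h2 h4
    have hE : (energy ξ : ℂ) ≠ 0 := ofReal_ne_zero.2 (energy_pos ξ).ne'
    have h3 := congrArg (fun v => ((energy ξ : ℂ) ^ 2) • v)
      (h1.symm.trans (h4.trans (congrArg Neg.neg h2)))
    simp only [resSym, absSym, _root_.smul_apply, _root_.one_apply_eq_self, smul_smul,
      smul_neg] at h3
    rw [show (energy ξ : ℂ) ^ 2 * (((energy ξ)⁻¹ ^ 2 : ℝ) : ℂ) = 1 by push_cast; field_simp,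
      show (energy ξ : ℂ) ^ 2 * (((energy ξ)⁻¹ : ℝ) : ℂ) = energy ξ by push_cast; field_simp,
      one_smul] at h3
    rw [h3, ofReal_neg, neg_smul]

theorem ofReal_norm_sq_eq_lintegral (g : DSp) :
    ENNReal.ofReal (‖g‖ ^ 2) = ∫⁻ ξ, ‖g ξ‖ₑ ^ 2 := by
  have h := eLpNorm_nnreal_pow_eq_lintegral (f := g) (μ := volume) (p := 2) two_ne_zero
  rw [ENNReal.ofReal_pow (norm_nonneg _), ofReal_norm, Lp.enorm_def]
  simpa using h

theorem lintegral_energy_fourierL2 {u : DSp}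
    (hu : u ∈ (sqrtAbsPMap (fourierMul resMul)).domain) :
    ∫⁻ ξ, ENNReal.ofReal (energy ξ) * ‖fourierL2 u ξ‖ₑ ^ 2 =
      ENNReal.ofReal (‖pApply (sqrtAbsPMap (fourierMul resMul)) u‖ ^ 2) := by
  rw [sqrtAbsPMap, invSqrtAbs_fourierMul_resMul] at hu ⊢
  have hJ : ∀ v, fourierMul sqrtMul v = 0 → v = 0 := fun v hv => by
    rw [fourierMul_apply, LinearIsometryEquiv.map_eq_zero_iff] at hv
    exact fourierL2.map_eq_zero_iff.1 (sqrtMul_injective hv)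
  have h := eq_apply_pApply_pinv hJ hu
  set w := pApply (pinv (fourierMul sqrtMul)) u
  have hF : fourierL2 u = sqrtMul (fourierL2 w) := by
    rw [← h, fourierMul_apply, LinearIsometryEquiv.apply_symm_apply]
  rw [← fourierL2.norm_map w, ofReal_norm_sq_eq_lintegral]
  refine lintegral_congr_ae ?_
  filter_upwards [symbolMul_ae continuous_sqrtSym norm_sqrtSym_le (fourierL2 w)] with ξ h1
  change sqrtMul (fourierL2 w) ξ = _ at h1
  have hE := energy_pos ξ
  rw [hF, h1, sqrtSym, _root_.smul_apply, _root_.one_apply_eq_self, enorm_smul, mul_pow,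
    ← mul_assoc,
    ← ofReal_norm, norm_real, Real.norm_of_nonneg (Real.sqrt_nonneg _),
    ← ENNReal.ofReal_pow (Real.sqrt_nonneg _), Real.sq_sqrt (energy_inv_mem ξ).1,
    ← ENNReal.ofReal_mul hE.le, mul_inv_cancel₀ hE.ne', ENNReal.ofReal_one, one_mul]

open scoped SchwartzMap FourierTransform in
theorem fourierL2_symm_ae {G : DSp} (hG : Integrable G) :
    ∀ᵐ x, fourierL2.symm G x = 𝓕⁻ (G : V3 → C4) x := by
  have hc : Continuous (𝓕⁻ (G : V3 → C4)) := by
    refine VectorFourier.fourierIntegral_continuous Real.continuous_fourierChar ?_ hG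
    simpa using! continuous_inner.neg
  refine ae_eq_of_integral_contDiff_smul_eq
    ((Lp.memLp (fourierL2.symm G)).locallyIntegrable one_le_two) hc.locallyIntegrable
    fun g hg hgc => ?_
  have hs : HasCompactSupport fun x => (g x : ℂ) := hgc.comp_left ofReal_zero
  have hd : ContDiff ℝ (⊤ : ℕ∞) fun x => (g x : ℂ) := ofRealCLM.contDiff.comp hg
  set φ : 𝓢(V3, ℂ) := hs.toSchwartzMap hd
  have hφ : ∀ x, φ x = (g x : ℂ) := fun x => rfl
  have h1 := congrArg (fun T => T φ) (Lp.fourierInv_toTemperedDistribution_eq G)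
  simp only [TemperedDistribution.fourierInv_apply, Lp.toTemperedDistribution_apply] at h1
  have h2 : ∫ x, 𝓕⁻ φ x • G x = ∫ x, φ x • 𝓕⁻ (G : V3 → C4) x := by
    rw [SchwartzMap.fourierInv_coe]
    have := VectorFourier.integral_fourierIntegral_smul_eq_flip (L := -innerₗ V3)
      (μ := volume) (ν := volume) Real.continuous_fourierChar
      (by simpa using! continuous_inner.neg) φ.integrable hG
    refine this.trans ?_
    have hf : (-innerₗ V3).flip = -innerₗ V3 := by
      ext x y
      simp [real_inner_comm]
    rw [hf]
    rfl
  have h3 := h1.symm.trans h2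
  simp only [hφ, coe_smul] at h3
  exact h3

theorem lintegral_coulomb_le_of_integrable {G : DSp} (hG : Integrable G) {ρ : V3 → ℝ}
    (hρ : (∀ ξ, ρ ξ = energy ξ) ∨ ∀ ξ, ρ ξ = -energy ξ)
    (hD : ∀ᵐ ξ, diracSym ξ (G ξ) = (ρ ξ : ℂ) • G ξ) :
    ∫⁻ x, ‖fourierL2.symm G x‖ₑ ^ 2 * ENNReal.ofReal (1 / ‖x‖) ≤
      ∫⁻ ξ, ENNReal.ofReal (tixConst * energy ξ) * ‖G ξ‖ₑ ^ 2 := by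
  refine Eq.trans_le ?_ (coulombEnergy_le_tix hG (Lp.stronglyMeasurable G).measurable hρ hD)
  refine lintegral_congr_ae ?_
  filter_upwards [fourierL2_symm_ae hG] with x hx
  rw [hx]

/-- The truncation of an `L²` function to a ball of radius `n`. -/
def truncBall (v : DSp) (n : ℕ) : DSp :=
  ((Lp.memLp v).indicator (s := Metric.ball 0 n) measurableSet_ball).toLp _

theorem truncBall_ae (v : DSp) (n : ℕ) :
    ∀ᵐ ξ, truncBall v n ξ = (Metric.ball (0 : V3) n).indicator v ξ :=
  MemLp.coeFn_toLp _

theorem integrable_truncBall (v : DSp) (n : ℕ) : Integrable (truncBall v n) := by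
  refine Integrable.congr ?_ (EventuallyEq.symm (truncBall_ae v n))
  rw [integrable_indicator_iff measurableSet_ball]
  have : IsFiniteMeasure (volume.restrict (Metric.ball (0 : V3) n)) :=
    ⟨by rw [Measure.restrict_apply_univ]; exact measure_ball_lt_top⟩
  exact ((Lp.memLp v).restrict _).integrable one_le_two

theorem tendsto_truncBall (v : DSp) : Tendsto (truncBall v) atTop (𝓝 v) := by
  rw [tendsto_iff_norm_sub_tendsto_zero]
  have h : Tendsto (fun n => ∫⁻ ξ, ‖(truncBall v n - v) ξ‖ₑ ^ 2) atTop (𝓝 (∫⁻ _ : V3, 0)) := by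
    refine tendsto_lintegral_of_dominated_convergence' (fun ξ => ‖v ξ‖ₑ ^ 2)
      (fun n => by fun_prop) (fun n => ?_) ?_ ?_
    · filter_upwards [truncBall_ae v n, Lp.coeFn_sub (truncBall v n) v] with ξ h1 h2
      rw [h2, Pi.sub_apply, h1]
      gcongr
      by_cases hξ : ξ ∈ Metric.ball (0 : V3) n <;> simp [hξ]
    · rw [← ofReal_norm_sq_eq_lintegral]
      exact ENNReal.ofReal_ne_top
    · filter_upwards [ae_all_iff.2 (truncBall_ae v),
        ae_all_iff.2 fun n => Lp.coeFn_sub (truncBall v n) v] with ξ h1 h2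
      obtain ⟨N, hN⟩ := exists_nat_gt ‖ξ‖
      refine tendsto_const_nhds.congr' ?_
      filter_upwards [eventually_ge_atTop N] with n hn
      have hm : ξ ∈ Metric.ball (0 : V3) n := by
        rw [mem_ball_zero_iff]
        exact hN.trans_le (by exact_mod_cast hn)
      rw [h2, Pi.sub_apply, h1, Set.indicator_of_mem hm, sub_self, enorm_zero]
      simp
  simp only [← ofReal_norm_sq_eq_lintegral, lintegral_zero] at h
  have h' := (ENNReal.tendsto_toReal ENNReal.zero_ne_top).comp h
  have h2 : Tendsto (fun n => √(‖truncBall v n - v‖ ^ 2)) atTop (𝓝 √0) := by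
    refine (Real.continuous_sqrt.tendsto 0).comp ?_
    refine h'.congr fun n => ?_
    simp
  simpa using h2

theorem lintegral_coulomb_le {u : DSp} {ρ : V3 → ℝ}
    (hρ : (∀ ξ, ρ ξ = energy ξ) ∨ ∀ ξ, ρ ξ = -energy ξ)
    (hD : ∀ᵐ ξ, diracSym ξ (fourierL2 u ξ) = (ρ ξ : ℂ) • fourierL2 u ξ) :
    ∫⁻ x, ‖u x‖ₑ ^ 2 * ENNReal.ofReal (1 / ‖x‖) ≤
      ENNReal.ofReal tixConst * ∫⁻ ξ, ENNReal.ofReal (energy ξ) * ‖fourierL2 u ξ‖ₑ ^ 2 := by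
  have ht : 0 ≤ tixConst := by
    unfold tixConst
    have := Real.pi_pos
    positivity
  set v := fourierL2 u with hv
  have hb : ∀ n, ∫⁻ x, ‖fourierL2.symm (truncBall v n) x‖ₑ ^ 2 * ENNReal.ofReal (1 / ‖x‖) ≤
      ENNReal.ofReal tixConst * ∫⁻ ξ, ENNReal.ofReal (energy ξ) * ‖v ξ‖ₑ ^ 2 := fun n => by
    refine (lintegral_coulomb_le_of_integrable (integrable_truncBall v n) hρ ?_).trans ?_
    · filter_upwards [truncBall_ae v n, hD] with ξ h1 h2
      rw [h1]
      by_cases hξ : ξ ∈ Metric.ball (0 : V3) n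
      · rw [Set.indicator_of_mem hξ, h2]
      · rw [Set.indicator_of_notMem hξ, map_zero, smul_zero]
    · rw [← lintegral_const_mul' _ _ ENNReal.ofReal_ne_top]
      refine lintegral_mono_ae ?_
      filter_upwards [truncBall_ae v n] with ξ h1
      rw [h1, ENNReal.ofReal_mul ht, mul_assoc]
      gcongr
      by_cases hξ : ξ ∈ Metric.ball (0 : V3) n <;> simp [hξ]
  have hlim : Tendsto (fun n => fourierL2.symm (truncBall v n)) atTop (𝓝 u) := by
    have := (fourierL2.symm.continuous.tendsto v).comp (tendsto_truncBall v)
    rwa [hv, LinearIsometryEquiv.symm_apply_apply] at this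
  obtain ⟨ns, -, hns⟩ := (tendstoInMeasure_of_tendsto_Lp hlim).exists_seq_tendsto_ae
  calc ∫⁻ x, ‖u x‖ₑ ^ 2 * ENNReal.ofReal (1 / ‖x‖)
      ≤ ∫⁻ x, liminf (fun k => ‖fourierL2.symm (truncBall v (ns k)) x‖ₑ ^ 2 *
          ENNReal.ofReal (1 / ‖x‖)) atTop := by
        refine lintegral_mono_ae ?_
        filter_upwards [hns] with x hx
        refine le_of_eq (Tendsto.liminf_eq ?_).symm
        exact ENNReal.Tendsto.mul_const (ENNReal.Tendsto.pow hx.enorm)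
          (Or.inr ENNReal.ofReal_ne_top)
    _ ≤ liminf (fun k => ∫⁻ x, ‖fourierL2.symm (truncBall v (ns k)) x‖ₑ ^ 2 *
          ENNReal.ofReal (1 / ‖x‖)) atTop := by
        refine lintegral_liminf_le' fun k => ?_
        have : Measurable fun x : V3 => ENNReal.ofReal (1 / ‖x‖) := by fun_prop
        exact ((Lp.aestronglyMeasurable _).enorm.pow_const 2).mul this.aemeasurable
    _ ≤ _ := liminf_le_of_le (by isBoundedDefault) fun b hle => by
        obtain ⟨k, hk⟩ := hle.exists
        exact hk.trans (hb _)

/-!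
STATEMENT 14 (inequality of Tix / Burenkov–Evans for the Brown–Ravenhall operator):
Let `H₀` be the free Dirac operator on `ℝ³` and `P₊, P₋` its spectral projections onto the
positive and negative spectral subspaces (characterized via `R = H₀⁻¹`).  Then for every
`u ∈ P₊ dom(|H₀|^{1/2}) ∪ P₋ dom(|H₀|^{1/2})`,
`(|x|⁻¹ u, u) = ∫ |u(x)|²/|x| dx` is finite and
`|(|x|⁻¹u, u)| ≤ (1/2)(π/2 + 2/π) ‖|H₀|^{1/2} u‖²`.
-/

theorem statement_14
    (H0 : DSp →ₗ.[ℂ] DSp) (hH0 : IsFreeDirac H0)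
    (R : DSp →L[ℂ] DSp) (hR : IsResolventAt H0 0 R)
    (Pp Pm : DSp →L[ℂ] DSp) (hP : IsPosNegPair R Pp Pm)
    (u : DSp) (hu : u ∈ (sqrtAbsPMap R).domain) (hupm : Pp u = u ∨ Pm u = u) :
    MeasureTheory.Integrable (fun x : V3 => ‖(u : V3 → C4) x‖ ^ 2 / ‖x‖) volume ∧
    |∫ x : V3, ‖(u : V3 → C4) x‖ ^ 2 / ‖x‖| ≤
      (1 / 2) * (Real.pi / 2 + 2 / Real.pi) * ‖pApply (sqrtAbsPMap R) u‖ ^ 2 := by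
  have ht : 0 ≤ tixConst := by
    unfold tixConst
    have := Real.pi_pos
    positivity
  obtain rfl := resolvent_eq_fourierMul hH0 hR
  have key : ∫⁻ x, ‖u x‖ₑ ^ 2 * ENNReal.ofReal (1 / ‖x‖) ≤
      ENNReal.ofReal (tixConst * ‖pApply (sqrtAbsPMap (fourierMul resMul)) u‖ ^ 2) := by
    rw [ENNReal.ofReal_mul ht, ← lintegral_energy_fourierL2 hu]
    rcases diracSym_fourierL2 hP hupm with h | h
    · exact lintegral_coulomb_le (ρ := energy) (Or.inl fun _ => rfl) h
    · exact lintegral_coulomb_le (ρ := fun ξ => -energy ξ) (Or.inr fun _ => rfl) h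
  have hmeas : AEStronglyMeasurable (fun x : V3 => ‖u x‖ ^ 2 / ‖x‖) volume :=
    (((Lp.stronglyMeasurable u).measurable.norm.pow_const 2).div measurable_norm).aestronglyMeasurable
  have hnn : ∀ x : V3, 0 ≤ ‖u x‖ ^ 2 / ‖x‖ := fun x => by positivity
  have heq : ∀ x : V3, ENNReal.ofReal (‖u x‖ ^ 2 / ‖x‖) =
      ‖u x‖ₑ ^ 2 * ENNReal.ofReal (1 / ‖x‖) := fun x => by
    rw [div_eq_mul_one_div, ENNReal.ofReal_mul (by positivity),
      ENNReal.ofReal_pow (norm_nonneg _), ofReal_norm]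
  refine ⟨⟨hmeas, ?_⟩, ?_⟩
  · rw [hasFiniteIntegral_iff_ofReal (Eventually.of_forall hnn)]
    simp only [heq]
    exact key.trans_lt ENNReal.ofReal_lt_top
  · rw [abs_of_nonneg (integral_nonneg hnn),
      integral_eq_lintegral_of_nonneg_ae (Eventually.of_forall hnn) hmeas]
    simp only [heq]
    exact ENNReal.toReal_le_of_le_ofReal (mul_nonneg ht (sq_nonneg _)) key

end Paper
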